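/- The isomorphism problem for 6-generated recursively presented groups is a Σ⁰₃-complete equivalence relation: the equivalence relation on ℕ given by e ~ e' iff the group presented by the e-th c.e. presentation on 6 generators is isomorphic to the group presented by the e'-th such presentation is Σ⁰₃ (as a subset of ℕ² under a computable pairing), and every Σ⁰₃ equivalence relation on ℕ computably reduces to it. -/

import Mathlib

/-- The `e`-th computably enumerable subset of `ℕ`: the domain of the `e`-th partial
computable function. -/
def W (e : ℕ) : Set ℕ := {n | ((Denumerable.ofNat Nat.Partrec.Code e).eval n).Dom}

/-- A set `S ⊆ ℕ` is Σ⁰₃ if there is a computable predicate `R ⊆ ℕ⁴` with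
`n ∈ S ↔ ∃x ∀y ∃z, R n x y z`. -/
def IsSigma03 (S : Set ℕ) : Prop :=
  ∃ R : ℕ → ℕ → ℕ → ℕ → Bool,
    (Computable fun p : ℕ × ℕ × ℕ × ℕ => R p.1 p.2.1 p.2.2.1 p.2.2.2) ∧
    ∀ n, n ∈ S ↔ ∃ x, ∀ y, ∃ z, R n x y z = true

/-- A binary relation on `ℕ` is Σ⁰₃ if the corresponding set of codes of pairs
(under the standard computable pairing) is Σ⁰₃. -/
def Sigma03Rel (E : ℕ → ℕ → Prop) : Prop :=
  IsSigma03 {p : ℕ | E p.unpair.1 p.unpair.2}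

/-- `E` computably reduces to `F`: there is a total computable `Φ` with
`m E n ↔ Φ(m) F Φ(n)`. -/
def ComputableReduction (E F : ℕ → ℕ → Prop) : Prop :=
  ∃ Φ : ℕ → ℕ, Computable Φ ∧ ∀ m n, E m n ↔ F (Φ m) (Φ n)

/-- Code of an element of the free group on `Fin k`, via its reduced word. -/
def encodeFG {k : ℕ} (g : FreeGroup (Fin k)) : ℕ := Encodable.encode g.toWord

/-- The relator set of the `e`-th c.e. presentation on `k` generators: the set of elements
of the free group on `k` generators whose codes lie in `W e`.  The presented group
`⟨x₁,…,x_k ∣ relSet k e⟩` is `PresentedGroup (relSet k e)`, the quotient of the free group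
by the normal closure of this set. -/
def relSet (k e : ℕ) : Set (FreeGroup (Fin k)) := {g | encodeFG g ∈ W e}

/-- The isomorphism problem for `6`-generated recursively presented groups. -/
def GroupIso6 (e e' : ℕ) : Prop :=
  Nonempty (PresentedGroup (relSet 6 e) ≃* PresentedGroup (relSet 6 e'))

/-- Letters of words in the free group on six generators. -/
abbrev Letter : Type := Fin 6 × Bool

theorem primrec_reduce : Primrec (FreeGroup.reduce : List Letter → List Letter) := by
  have hstep : Primrec fun p : Letter × List Letter × List Letter =>
      (List.casesOn (motive := fun _ => List Letter) p.2.2 [p.1]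
        fun h t => if p.1.1 = h.1 ∧ p.1.2 = !h.2 then t else p.1 :: h :: t) := by
    refine Primrec.list_casesOn (f := fun p : Letter × List Letter × List Letter => p.2.2)
      (g := fun p => [p.1])
      (h := fun p q => if p.1.1 = q.1.1 ∧ p.1.2 = !q.1.2 then q.2 else p.1 :: q.1 :: q.2)
      (Primrec.snd.comp Primrec.snd)
      (Primrec.list_cons.comp Primrec.fst (Primrec.const ([] : List Letter))) ?_
    refine Primrec.ite (PrimrecPred.and ?_ ?_) (Primrec.snd.comp Primrec.snd) ?_
    · exact Primrec.eq.comp (Primrec.fst.comp (Primrec.fst.comp Primrec.fst))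
        (Primrec.fst.comp (Primrec.fst.comp Primrec.snd))
    · exact Primrec.eq.comp (Primrec.snd.comp (Primrec.fst.comp Primrec.fst))
        (Primrec.not.comp (Primrec.snd.comp (Primrec.fst.comp Primrec.snd)))
    · exact Primrec.list_cons.comp (Primrec.fst.comp Primrec.fst)
        (Primrec.list_cons.comp (Primrec.fst.comp Primrec.snd) (Primrec.snd.comp Primrec.snd))
  refine (Primrec.list_rec (f := fun L : List Letter => L) (g := fun _ => ([] : List Letter))
    Primrec.id (Primrec.const []) (h := fun _ p =>
      (List.casesOn (motive := fun _ => List Letter) p.2.2 [p.1]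
        fun h t => if p.1.1 = h.1 ∧ p.1.2 = !h.2 then t else p.1 :: h :: t))
    (hstep.comp Primrec.snd)).of_eq fun L => ?_
  induction L with
  | nil => rfl
  | cons a L ih => rw [FreeGroup.reduce.cons, ← ih]

theorem primrec_invRev : Primrec (FreeGroup.invRev : List Letter → List Letter) :=
  Primrec.list_reverse.comp (Primrec.list_map Primrec.id
    (Primrec.pair (Primrec.fst.comp Primrec.snd)
      (Primrec.not.comp (Primrec.snd.comp Primrec.snd))))

theorem primrec_replicate {α : Type*} [Primcodable α] :
    Primrec₂ (List.replicate : ℕ → α → List α) :=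
  (Primrec.list_map (g := fun (p : ℕ × α) _ => p.2) (Primrec.list_range.comp Primrec.fst)
    (Primrec.snd.comp Primrec.fst)).of_eq fun p => by simp

theorem primrec_pow : Primrec₂ ((· ^ ·) : ℕ → ℕ → ℕ) :=
  (Primrec.nat_rec' (f := fun p : ℕ × ℕ => p.2) (g := fun _ => 1)
    (h := fun p q => q.2 * p.1) Primrec.snd (Primrec.const 1)
    (Primrec.nat_mul.comp (Primrec.snd.comp Primrec.snd) (Primrec.fst.comp Primrec.fst))).of_eq
    fun p => by
      obtain ⟨a, n⟩ := p
      induction n with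
      | zero => simp
      | succ n ih => simp only [pow_succ] at *; rw [← ih]

/-- The word `x₀ⁿ` (for `b = true`) or `x₀⁻ⁿ` (for `b = false`). -/
def shiftWord (b : Bool) (n : ℕ) : List Letter := List.replicate n (0, b)

/-- The conjugate of `x₁` by `x₀ⁿ` or by `x₀⁻ⁿ`. -/
def baseWord (b : Bool) (n : ℕ) : List Letter :=
  shiftWord b n ++ (1, true) :: shiftWord (!b) n

/-- The commutator of two words. -/
def commWord (u v : List Letter) : List Letter :=
  u ++ (v ++ (FreeGroup.invRev u ++ FreeGroup.invRev v))

/-- The marker word of index `n` at level `l`. -/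
def markWord (n l : ℕ) : List Letter :=
  baseWord true (4 ^ l) ++ (baseWord false (Nat.pair l n + 1) ++ baseWord false (Nat.pair l n + 1))

/-- The word attached to the edge `e` at level `l`; an edge `e` codes a triple
consisting of its two end points and a witness. -/
def edgeWord (l e : ℕ) : List Letter :=
  baseWord true (4 ^ l + 2 * 4 ^ e) ++ (baseWord false (Nat.pair l e.unpair.1 + 1) ++
    baseWord false (Nat.pair l e.unpair.2.unpair.1 + 1))

/-- The relators, listed by a type `k.unpair.1` and a parameter `k.unpair.2`. -/
def relWord (n k : ℕ) : List Letter :=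
  [List.replicate 4 (1, true), commWord [(1, true)] (baseWord true k.unpair.2),
    List.replicate 3 (2, true), commWord [(2, true)] (markWord n k.unpair.2),
    [(3, true)], [(4, true)], [(5, true)]].getD k.unpair.1
    (commWord [(2, true)]
      (edgeWord k.unpair.2.unpair.1 k.unpair.2.unpair.2.unpair.1 ++
        edgeWord k.unpair.2.unpair.1 k.unpair.2.unpair.2.unpair.1))

/-- The relators, where a relator attached to an edge is dropped if its stage is not good. -/
def stagedRelWord (good : ℕ → ℕ → ℕ → Bool) (n k : ℕ) : List Letter :=
  bif decide (7 ≤ k.unpair.1) && !good k.unpair.2.unpair.2.unpair.1 k.unpair.2.unpair.1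
    k.unpair.2.unpair.2.unpair.2 then [] else relWord n k

section primrec
open Primrec

theorem primrec_shiftWord (b : Bool) : Primrec (shiftWord b) :=
  primrec_replicate.comp Primrec.id (Primrec.const (0, b))

theorem primrec_baseWord (b : Bool) : Primrec (baseWord b) :=
  list_append.comp (primrec_shiftWord b) (list_cons.comp (const _) (primrec_shiftWord (!b)))

theorem primrec_commWord : Primrec₂ commWord :=
  list_append.comp fst (list_append.comp snd (list_append.comp (primrec_invRev.comp fst)
    (primrec_invRev.comp snd)))

theorem primrec_markWord : Primrec₂ markWord := by
  have h : Primrec fun p : ℕ × ℕ => baseWord false (Nat.pair p.2 p.1 + 1) :=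
    (primrec_baseWord false).comp (succ.comp (Primrec₂.natPair.comp snd fst))
  exact list_append.comp ((primrec_baseWord true).comp (primrec_pow.comp (const 4) snd))
    (list_append.comp h h)

theorem primrec_edgeWord : Primrec₂ edgeWord := by
  have h₁ : Primrec fun p : ℕ × ℕ => p.2.unpair.1 := fst.comp (unpair.comp snd)
  have h₂ : Primrec fun p : ℕ × ℕ => p.2.unpair.2.unpair.1 :=
    fst.comp (unpair.comp (snd.comp (unpair.comp snd)))
  refine list_append.comp ((primrec_baseWord true).comp (nat_add.comp
    (primrec_pow.comp (const 4) fst) (nat_mul.comp (const 2) (primrec_pow.comp (const 4) snd))))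
    (list_append.comp ((primrec_baseWord false).comp (succ.comp (Primrec₂.natPair.comp fst h₁)))
    ((primrec_baseWord false).comp (succ.comp (Primrec₂.natPair.comp fst h₂))))

theorem primrec_relWord : Primrec₂ relWord := by
  have hk : Primrec fun p : ℕ × ℕ => p.2.unpair.1 := fst.comp (unpair.comp snd)
  have ha : Primrec fun p : ℕ × ℕ => p.2.unpair.2 := snd.comp (unpair.comp snd)
  have hl : Primrec fun p : ℕ × ℕ => p.2.unpair.2.unpair.1 := fst.comp (unpair.comp ha)
  have he : Primrec fun p : ℕ × ℕ => p.2.unpair.2.unpair.2.unpair.1 :=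
    fst.comp (unpair.comp (snd.comp (unpair.comp ha)))
  have hedge := primrec_edgeWord.comp hl he
  have hlist : Primrec fun p : ℕ × ℕ =>
      [List.replicate 4 (1, true), commWord [(1, true)] (baseWord true p.2.unpair.2),
        List.replicate 3 (2, true), commWord [(2, true)] (markWord p.1 p.2.unpair.2),
        [(3, true)], [(4, true)], [(5, true)]] :=
    list_cons.comp (const _) <| list_cons.comp
      (primrec_commWord.comp (const _) ((primrec_baseWord true).comp ha)) <|
    list_cons.comp (const _) <| list_cons.comp
      (primrec_commWord.comp (const _) (primrec_markWord.comp fst ha)) (const _)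
  have hget := (Primrec.list_getElem?.comp hlist hk)
  exact (Primrec.option_getD.comp hget
    (primrec_commWord.comp (const [(2, true)]) (list_append.comp hedge hedge))).of_eq fun p => by
      simp [relWord]

theorem computable_comp₃ {α : Type*} [Primcodable α] {f : ℕ → ℕ → ℕ → Bool}
    (hf : Computable fun p : ℕ × ℕ × ℕ => f p.1 p.2.1 p.2.2) {a b c : α → ℕ}
    (ha : Computable a) (hb : Computable b) (hc : Computable c) :
    Computable fun p => f (a p) (b p) (c p) :=
  hf.comp (ha.pair (hb.pair hc))

theorem computable_stagedRelWord {good : ℕ → ℕ → ℕ → Bool}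
    (hgood : Computable fun p : ℕ × ℕ × ℕ => good p.1 p.2.1 p.2.2) :
    Computable₂ (stagedRelWord good) := by
  have hk : Primrec fun p : ℕ × ℕ => p.2.unpair.1 := fst.comp (unpair.comp snd)
  have ha : Primrec fun p : ℕ × ℕ => p.2.unpair.2 := snd.comp (unpair.comp snd)
  have hl : Primrec fun p : ℕ × ℕ => p.2.unpair.2.unpair.1 := fst.comp (unpair.comp ha)
  have hb : Primrec fun p : ℕ × ℕ => p.2.unpair.2.unpair.2.unpair :=
    unpair.comp (snd.comp (unpair.comp ha))
  have htag : Computable fun p : ℕ × ℕ => decide (7 ≤ p.2.unpair.1) :=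
    (nat_le.decide.comp (const 7) hk).to_comp
  have hg : Computable fun p : ℕ × ℕ => good p.2.unpair.2.unpair.2.unpair.1
      p.2.unpair.2.unpair.1 p.2.unpair.2.unpair.2.unpair.2 :=
    computable_comp₃ hgood (fst.comp hb).to_comp hl.to_comp (snd.comp hb).to_comp
  have hng : Computable fun p : ℕ × ℕ => !good p.2.unpair.2.unpair.2.unpair.1
      p.2.unpair.2.unpair.1 p.2.unpair.2.unpair.2.unpair.2 := Primrec.not.to_comp.comp hg
  have hc : Computable fun p : ℕ × ℕ => decide (7 ≤ p.2.unpair.1) &&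
      !good p.2.unpair.2.unpair.2.unpair.1 p.2.unpair.2.unpair.1
        p.2.unpair.2.unpair.2.unpair.2 := Primrec.and.to_comp.comp htag hng
  have hr : Computable fun p : ℕ × ℕ => relWord p.1 p.2 := primrec_relWord.to_comp
  have hnil : Computable fun _ : ℕ × ℕ => ([] : List Letter) := Computable.const []
  exact (Computable.cond hc hnil hr).of_eq fun p => rfl

end primrec

/-- A uniformly computable family of sequences of words gives uniformly c.e. presentations. -/
theorem exists_computable_relSet {rel : ℕ → ℕ → List Letter} (hrel : Computable₂ rel) :
    ∃ Φ : ℕ → ℕ, Computable Φ ∧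
      ∀ n, relSet 6 (Φ n) = Set.range fun k => FreeGroup.mk (rel n k) := by
  let test : ℕ → ℕ → Bool := fun p k =>
    decide (Encodable.encode (FreeGroup.reduce (rel p.unpair.1 k)) = p.unpair.2)
  have htest : Computable₂ test := by
    refine (Primrec.eq (α := ℕ)).decide.to_comp.comp (Computable.encode.comp
      (primrec_reduce.to_comp.comp (hrel.comp (Computable.fst.comp
        (Computable.unpair.comp Computable.fst)) Computable.snd)))
      (Computable.snd.comp (Computable.unpair.comp Computable.fst))
  have hpart : Partrec fun p : ℕ => Nat.rfind fun k => (test p k : Part Bool) :=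
    Partrec.rfind htest.partrec₂
  obtain ⟨c, hc⟩ := Nat.Partrec.Code.exists_code.1 (Partrec.nat_iff.1 hpart)
  refine ⟨fun n => Encodable.encode (Nat.Partrec.Code.curry c n),
    (Primrec.encode.comp (Nat.Partrec.Code.primrec₂_curry.comp (Primrec.const c)
      Primrec.id)).to_comp, fun n => ?_⟩
  ext g
  have key : (Nat.rfind fun k => (test (Nat.pair n (encodeFG g)) k : Part Bool)).Dom ↔
      ∃ k, FreeGroup.mk (rel n k) = g := by
    have ht : ∀ k, test (Nat.pair n (encodeFG g)) k = true ↔ FreeGroup.mk (rel n k) = g := by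
      intro k
      simp [test, encodeFG, ← FreeGroup.toWord_mk, FreeGroup.toWord_inj]
    refine Nat.rfind_dom.trans ⟨?_, ?_⟩
    · rintro ⟨k, hk, -⟩
      exact ⟨k, (ht k).1 (Part.mem_some_iff.1 hk).symm⟩
    · rintro ⟨k, hk⟩
      exact ⟨k, Part.mem_some_iff.2 ((ht k).2 hk).symm, fun _ => trivial⟩
  rw [Set.mem_range, ← key]
  change (Nat.Partrec.Code.eval _ _).Dom ↔ _
  rw [Denumerable.ofNat_encode, Nat.Partrec.Code.eval_curry, hc]

/-- Whether the word `c` has been found to be a relator of the `e`-th presentation at stage `s`. -/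
def relStage (e s : ℕ) (c : List Letter) : Bool :=
  (Nat.Partrec.Code.evaln s (Denumerable.ofNat Nat.Partrec.Code e)
    (Encodable.encode (FreeGroup.reduce c))).isSome

theorem mk_mem_relSet {e : ℕ} {c : List Letter} :
    FreeGroup.mk c ∈ relSet 6 e ↔ ∃ s, relStage e s c = true := by
  change (Nat.Partrec.Code.eval _ _).Dom ↔ _
  simp only [relStage, encodeFG, FreeGroup.toWord_mk, Option.isSome_iff_exists, Part.dom_iff_mem]
  constructor
  · rintro ⟨x, hx⟩
    obtain ⟨s, hs⟩ := Nat.Partrec.Code.evaln_complete.1 hx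
    exact ⟨s, x, hs⟩
  · rintro ⟨s, x, hs⟩
    exact ⟨x, Nat.Partrec.Code.evaln_sound hs⟩

/-- A certificate for triviality in a presented group: a list of conjugating words, relators,
signs and stages. -/
abbrev Certificate : Type := List (List Letter × List Letter × Bool × ℕ)

/-- The product of conjugates of relators described by a certificate; invalid entries
are skipped. -/
def certWord (e : ℕ) (z : Certificate) : List Letter :=
  z.flatMap fun q => bif relStage e q.2.2.2 q.2.1 then
    q.1 ++ ((bif q.2.2.1 then q.2.1 else FreeGroup.invRev q.2.1) ++ FreeGroup.invRev q.1) else []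

/-- Whether the certificate `z` witnesses that `v` is trivial in the `e`-th presentation. -/
def trivialBy (e : ℕ) (v : List Letter) (z : Certificate) : Bool :=
  decide (FreeGroup.reduce (certWord e z) = FreeGroup.reduce v)

theorem mk_certWord_cons (e : ℕ) (q) (z : Certificate) :
    FreeGroup.mk (certWord e (q :: z)) =
      (bif relStage e q.2.2.2 q.2.1 then
        FreeGroup.mk q.1 * (bif q.2.2.1 then FreeGroup.mk q.2.1 else (FreeGroup.mk q.2.1)⁻¹) *
          (FreeGroup.mk q.1)⁻¹ else 1) * FreeGroup.mk (certWord e z) := by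
  obtain ⟨u, r, b, s⟩ := q
  cases h : relStage e s r <;> cases b <;>
    simp [certWord, h, FreeGroup.mul_mk, FreeGroup.inv_mk]

theorem mk_certWord_mem (e : ℕ) (z : Certificate) :
    FreeGroup.mk (certWord e z) ∈ Subgroup.normalClosure (relSet 6 e) := by
  induction z with
  | nil => exact one_mem _
  | cons q z ih =>
    rw [mk_certWord_cons]
    refine mul_mem ?_ ih
    cases h : relStage e q.2.2.2 q.2.1
    · exact one_mem _
    · have hr := Subgroup.subset_normalClosure (mk_mem_relSet.2 ⟨_, h⟩)
      refine Subgroup.normalClosure_normal.conj_mem _ ?_ _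
      cases q.2.2.1
      exacts [inv_mem hr, hr]

theorem mem_normalClosure_relSet {e : ℕ} {v : List Letter} :
    FreeGroup.mk v ∈ Subgroup.normalClosure (relSet 6 e) ↔ ∃ z, trivialBy e v z = true := by
  simp only [trivialBy, decide_eq_true_eq]
  refine ⟨fun hv => ?_, fun ⟨z, hz⟩ => FreeGroup.reduce.exact hz ▸ mk_certWord_mem e z⟩
  suffices h : ∀ g ∈ Subgroup.normalClosure (relSet 6 e), ∃ z, FreeGroup.mk (certWord e z) = g by
    obtain ⟨z, hz⟩ := h _ hv
    exact ⟨z, FreeGroup.reduce.sound hz⟩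
  have hconj : ∀ x ∈ Group.conjugatesOfSet (relSet 6 e), ∀ b : Bool, ∃ q, ∀ z,
      FreeGroup.mk (certWord e (q :: z)) = (bif b then x else x⁻¹) * FreeGroup.mk (certWord e z) := by
    intro x hx b
    obtain ⟨r, hr, hx⟩ := Group.mem_conjugatesOfSet_iff.1 hx
    obtain ⟨c, rfl⟩ := isConj_iff.1 hx
    obtain ⟨s, hs⟩ := mk_mem_relSet.1 (r.mk_toWord.symm ▸ hr)
    refine ⟨(c.toWord, r.toWord, b, s), fun z => ?_⟩
    rw [mk_certWord_cons]
    cases b <;> simp [hs, FreeGroup.mk_toWord, mul_assoc]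
  intro g hg
  induction hg using Subgroup.closure_induction_left with
  | one => exact ⟨[], rfl⟩
  | mul_left x hx y _ ih =>
    obtain ⟨z, rfl⟩ := ih
    obtain ⟨q, hq⟩ := hconj x hx true
    exact ⟨q :: z, hq z⟩
  | inv_mul_cancel x hx y _ ih =>
    obtain ⟨z, rfl⟩ := ih
    obtain ⟨q, hq⟩ := hconj x hx false
    exact ⟨q :: z, hq z⟩

/-- Substitution of the words listed in `g` for the generators in the word `c`. -/
def substWord (g : List (List Letter)) (c : List Letter) : List Letter :=
  c.flatMap fun a => bif a.2 then g.getD a.1 [] else FreeGroup.invRev (g.getD a.1 [])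

theorem mk_substWord (g : List (List Letter)) (c : List Letter) :
    FreeGroup.mk (substWord g c) =
      FreeGroup.lift (fun i : Fin 6 => FreeGroup.mk (g.getD i [])) (FreeGroup.mk c) := by
  induction c with
  | nil => rfl
  | cons a c ih =>
    have h : FreeGroup.mk (substWord g (a :: c)) =
        (bif a.2 then FreeGroup.mk (g.getD a.1 []) else (FreeGroup.mk (g.getD a.1 []))⁻¹) *
          FreeGroup.mk (substWord g c) := by
      obtain ⟨i, b⟩ := a
      cases b <;> simp [substWord, FreeGroup.mul_mk, FreeGroup.inv_mk]
    rw [h, ih, FreeGroup.lift_mk, FreeGroup.lift_mk, List.map_cons, List.prod_cons]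

/-- Half of the conditions, tested on one word `c`, saying that substituting the words `g` and `h`
defines mutually inverse homomorphisms between the presentations `e` and `e'`. -/
def isoHalf (e e' : ℕ) (g h : List (List Letter)) (c : List Letter) (s : ℕ)
    (z z' : Certificate) : Bool :=
  (!relStage e s c || trivialBy e' (substWord g c) z) &&
    trivialBy e (FreeGroup.invRev c ++ substWord h (substWord g c)) z'

/-- The substitution homomorphism between free groups followed by the projection to a
presented group. -/
def substHom (e' : ℕ) (g : List (List Letter)) : FreeGroup (Fin 6) →* PresentedGroup (relSet 6 e') :=
  (PresentedGroup.mk _).comp (FreeGroup.lift fun i : Fin 6 => FreeGroup.mk (g.getD i []))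

theorem exists_isoHalf_iff {e e' : ℕ} {g h : List (List Letter)} {c : List Letter} {s : ℕ} :
    (∃ z z', isoHalf e e' g h c s z z' = true) ↔
      (relStage e s c = true → substHom e' g (FreeGroup.mk c) = 1) ∧
        substHom e h (FreeGroup.mk (substWord g c)) = PresentedGroup.mk _ (FreeGroup.mk c) := by
  have h₁ : substHom e' g (FreeGroup.mk c) = 1 ↔ ∃ z, trivialBy e' (substWord g c) z = true := by
    rw [← mem_normalClosure_relSet, mk_substWord]
    exact PresentedGroup.mk_eq_one_iff
  have h₂ : substHom e h (FreeGroup.mk (substWord g c)) = PresentedGroup.mk _ (FreeGroup.mk c) ↔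
      ∃ z, trivialBy e (FreeGroup.invRev c ++ substWord h (substWord g c)) z = true := by
    rw [← mem_normalClosure_relSet, ← FreeGroup.mul_mk, ← FreeGroup.inv_mk, mk_substWord h,
      ← PresentedGroup.mk_eq_one_iff, map_mul, map_inv, inv_mul_eq_one, eq_comm]
    rfl
  rw [h₁, h₂]
  simp only [isoHalf, Bool.and_eq_true, Bool.or_eq_true, Bool.not_eq_true']
  cases relStage e s c <;> simp

/-- The homomorphism of presented groups induced by a substitution. -/
theorem exists_hom_of_subst {e e' : ℕ} {g : List (List Letter)}
    (h : ∀ c s, relStage e s c = true → substHom e' g (FreeGroup.mk c) = 1) :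
    ∃ φ : PresentedGroup (relSet 6 e) →* PresentedGroup (relSet 6 e'),
      ∀ x, φ (PresentedGroup.mk _ x) = substHom e' g x := by
  have hle : Subgroup.normalClosure (relSet 6 e) ≤ (substHom e' g).ker := by
    refine Subgroup.normalClosure_le_normal fun r hr => ?_
    obtain ⟨s, hs⟩ := mk_mem_relSet.1 (r.mk_toWord.symm ▸ hr)
    exact r.mk_toWord ▸ h _ s hs
  exact ⟨QuotientGroup.lift _ (substHom e' g) hle, fun x => rfl⟩

/-- Every homomorphism between presented groups is induced by a substitution. -/
theorem exists_subst_of_hom {e e' : ℕ}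
    (φ : PresentedGroup (relSet 6 e) →* PresentedGroup (relSet 6 e')) :
    ∃ g : List (List Letter), ∀ x, φ (PresentedGroup.mk _ x) = substHom e' g x := by
  choose f hf using fun i : Fin 6 => PresentedGroup.mk_surjective _ (φ (PresentedGroup.of i))
  refine ⟨List.ofFn fun i => (f i).toWord, fun x => ?_⟩
  refine DFunLike.congr_fun (FreeGroup.ext_hom (φ.comp (PresentedGroup.mk _)) _ fun i => ?_) x
  simp only [substHom, MonoidHom.comp_apply, FreeGroup.lift_apply_of]
  rw [List.getD_eq_getElem _ _ (by simp)]
  simp only [List.getElem_ofFn, FreeGroup.mk_toWord]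
  exact (hf i).symm

theorem groupIso6_iff {e e' : ℕ} :
    GroupIso6 e e' ↔ ∃ g h, ∀ c s, ∃ z₁ z₂ z₃ z₄,
      (isoHalf e e' g h c s z₁ z₂ && isoHalf e' e h g c s z₃ z₄) = true := by
  have hsplit : ∀ g h c s, (∃ z₁ z₂ z₃ z₄,
      (isoHalf e e' g h c s z₁ z₂ && isoHalf e' e h g c s z₃ z₄) = true) ↔
      (∃ z z', isoHalf e e' g h c s z z' = true) ∧
        ∃ z z', isoHalf e' e h g c s z z' = true := by
    intro g h c s
    simp only [Bool.and_eq_true]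
    constructor
    · rintro ⟨z₁, z₂, z₃, z₄, h₁, h₂⟩
      exact ⟨⟨z₁, z₂, h₁⟩, z₃, z₄, h₂⟩
    · rintro ⟨⟨z₁, z₂, h₁⟩, z₃, z₄, h₂⟩
      exact ⟨z₁, z₂, z₃, z₄, h₁, h₂⟩
  have hsubst : ∀ {a b : ℕ} {φ : PresentedGroup (relSet 6 a) →* PresentedGroup (relSet 6 b)}
      {g : List (List Letter)}, (∀ x, φ (PresentedGroup.mk _ x) = substHom b g x) →
      ∀ c, PresentedGroup.mk _ (FreeGroup.mk (substWord g c)) =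
        φ (PresentedGroup.mk _ (FreeGroup.mk c)) := by
    intro a b φ g hg c
    rw [hg, mk_substWord]
    rfl
  simp only [hsplit, exists_isoHalf_iff]
  constructor
  · rintro ⟨φ⟩
    have half : ∀ {a b : ℕ} (φ : PresentedGroup (relSet 6 a) ≃* PresentedGroup (relSet 6 b))
        {g h : List (List Letter)}, (∀ x, φ (PresentedGroup.mk _ x) = substHom b g x) →
        (∀ x, φ.symm (PresentedGroup.mk _ x) = substHom a h x) → ∀ c s,
        (relStage a s c = true → substHom b g (FreeGroup.mk c) = 1) ∧
          substHom a h (FreeGroup.mk (substWord g c)) =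
            PresentedGroup.mk _ (FreeGroup.mk c) := by
      intro a b φ g h hg hh c s
      refine ⟨fun hs => ?_, ?_⟩
      · rw [← hg, PresentedGroup.mk_eq_one_iff.2
          (Subgroup.subset_normalClosure (mk_mem_relSet.2 ⟨s, hs⟩)), map_one]
      · rw [← hh, hsubst (φ := φ.toMonoidHom) hg]
        exact φ.symm_apply_apply _
    obtain ⟨g, hg⟩ := exists_subst_of_hom φ.toMonoidHom
    obtain ⟨h, hh⟩ := exists_subst_of_hom φ.symm.toMonoidHom
    exact ⟨g, h, fun c s => ⟨half φ hg hh c s, half φ.symm hh hg c s⟩⟩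
  · rintro ⟨g, h, H⟩
    obtain ⟨φ, hφ⟩ := exists_hom_of_subst fun c s => (H c s).1.1
    obtain ⟨ψ, hψ⟩ := exists_hom_of_subst fun c s => (H c s).2.1
    have inv : ∀ {a b : ℕ} {φ : PresentedGroup (relSet 6 a) →* PresentedGroup (relSet 6 b)}
        {ψ : PresentedGroup (relSet 6 b) →* PresentedGroup (relSet 6 a)}
        {g h : List (List Letter)}, (∀ x, φ (PresentedGroup.mk _ x) = substHom b g x) →
        (∀ x, ψ (PresentedGroup.mk _ x) = substHom a h x) →
        (∀ c, substHom a h (FreeGroup.mk (substWord g c)) =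
          PresentedGroup.mk _ (FreeGroup.mk c)) → ∀ x, ψ (φ x) = x := by
      intro a b φ ψ g h hφ hψ H x
      obtain ⟨x, rfl⟩ := PresentedGroup.mk_surjective _ x
      have := H x.toWord
      rw [← hψ, hsubst hφ, FreeGroup.mk_toWord] at this
      exact this
    exact ⟨MulEquiv.mk' ⟨φ, ψ, inv hφ hψ fun c => (H c 0).1.2, inv hψ hφ fun c => (H c 0).2.2⟩
      fun x y => map_mul φ x y⟩

theorem isSigma03_of_computable {α β γ : Type} [Primcodable α] [Primcodable β] [Primcodable γ]
    [Inhabited α] [Inhabited β] [Inhabited γ] {S : Set ℕ} {R : ℕ × α × β × γ → Bool}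
    (hR : Computable R) (hS : ∀ n, n ∈ S ↔ ∃ x, ∀ y, ∃ z, R (n, x, y, z) = true) :
    IsSigma03 S := by
  have hdec : ∀ {δ : Type} [Primcodable δ] [Inhabited δ],
      Computable fun n : ℕ => ((Encodable.decode n : Option δ)).getD default :=
    fun {δ} _ _ => (Primrec.option_getD_default.comp Primrec.decode).to_comp
  refine ⟨fun n x y z => R (n, (Encodable.decode x).getD default, (Encodable.decode y).getD default,
    (Encodable.decode z).getD default), hR.comp (Computable.fst.pair
      ((hdec.comp (Computable.fst.comp Computable.snd)).pair
        ((hdec.comp (Computable.fst.comp (Computable.snd.comp Computable.snd))).pair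
          (hdec.comp (Computable.snd.comp (Computable.snd.comp Computable.snd)))))), fun n => ?_⟩
  have hsurj : ∀ {δ : Type} [Primcodable δ] [Inhabited δ],
      Function.Surjective fun n : ℕ => ((Encodable.decode n : Option δ)).getD default :=
    fun {δ} _ _ d => ⟨Encodable.encode d, by simp⟩
  rw [hS, hsurj.exists]
  refine exists_congr fun x => ?_
  rw [hsurj.forall]
  refine forall_congr' fun y => ?_
  rw [hsurj.exists]

section primrec
open Primrec
variable {α : Type*} [Primcodable α]

theorem primrec_relStage {e s : α → ℕ} {c : α → List Letter} (he : Primrec e) (hs : Primrec s)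
    (hc : Primrec c) : Primrec fun a => relStage (e a) (s a) (c a) :=
  option_isSome.comp (Nat.Partrec.Code.primrec_evaln.comp
    ((hs.pair ((Primrec.ofNat _).comp he)).pair (Primrec.encode.comp (primrec_reduce.comp hc))))

theorem primrec_certWord {e : α → ℕ} {z : α → Certificate} (he : Primrec e) (hz : Primrec z) :
    Primrec fun a => certWord (e a) (z a) := by
  have hq₁ : Primrec fun p : α × (List Letter × List Letter × Bool × ℕ) => p.2.1 := fst.comp snd
  have hq₂ : Primrec fun p : α × (List Letter × List Letter × Bool × ℕ) => p.2.2.1 :=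
    fst.comp (snd.comp snd)
  have hq₃ : Primrec fun p : α × (List Letter × List Letter × Bool × ℕ) => p.2.2.2.1 :=
    fst.comp (snd.comp (snd.comp snd))
  have hq₄ : Primrec fun p : α × (List Letter × List Letter × Bool × ℕ) => p.2.2.2.2 :=
    snd.comp (snd.comp (snd.comp snd))
  refine list_flatMap hz (Primrec.cond (primrec_relStage (he.comp fst) hq₄ hq₂)
    (list_append.comp hq₁ (list_append.comp (Primrec.cond hq₃ hq₂ (primrec_invRev.comp hq₂))
      (primrec_invRev.comp hq₁))) (const []))

theorem primrec_trivialBy {e : α → ℕ} {v : α → List Letter} {z : α → Certificate}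
    (he : Primrec e) (hv : Primrec v) (hz : Primrec z) :
    Primrec fun a => trivialBy (e a) (v a) (z a) :=
  Primrec.eq.decide.comp (primrec_reduce.comp (primrec_certWord he hz)) (primrec_reduce.comp hv)

theorem primrec_substWord {g : α → List (List Letter)} {c : α → List Letter}
    (hg : Primrec g) (hc : Primrec c) : Primrec fun a => substWord (g a) (c a) := by
  have hget : Primrec fun p : α × Letter => (g p.1).getD p.2.1 [] :=
    (list_getD []).comp (hg.comp fst) (Primrec.fin_val.comp (fst.comp snd))
  exact list_flatMap hc (Primrec.cond (snd.comp snd) hget (primrec_invRev.comp hget))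

theorem primrec_isoHalf {e e' s : α → ℕ} {g h : α → List (List Letter)} {c : α → List Letter}
    {z z' : α → Certificate} (he : Primrec e) (he' : Primrec e') (hg : Primrec g) (hh : Primrec h)
    (hc : Primrec c) (hs : Primrec s) (hz : Primrec z) (hz' : Primrec z') :
    Primrec fun a => isoHalf (e a) (e' a) (g a) (h a) (c a) (s a) (z a) (z' a) :=
  Primrec.and.comp
    (Primrec.or.comp (Primrec.not.comp (primrec_relStage he hs hc))
      (primrec_trivialBy he' (primrec_substWord hg hc) hz))
    (primrec_trivialBy he (list_append.comp (primrec_invRev.comp hc)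
      (primrec_substWord hh (primrec_substWord hg hc))) hz')

end primrec

theorem sigma03Rel_groupIso6 : Sigma03Rel GroupIso6 := by
  let T : Type := ℕ × (List (List Letter) × List (List Letter)) × (List Letter × ℕ) ×
    (Certificate × Certificate) × (Certificate × Certificate)
  have he : Primrec fun p : T => p.1.unpair.1 := Primrec.fst.comp (Primrec.unpair.comp Primrec.fst)
  have he' : Primrec fun p : T => p.1.unpair.2 := Primrec.snd.comp (Primrec.unpair.comp Primrec.fst)
  have hx : Primrec fun p : T => p.2.1 := Primrec.fst.comp Primrec.snd
  have hy : Primrec fun p : T => p.2.2.1 := Primrec.fst.comp (Primrec.snd.comp Primrec.snd)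
  have hz : Primrec fun p : T => p.2.2.2 := Primrec.snd.comp (Primrec.snd.comp Primrec.snd)
  refine isSigma03_of_computable (R := fun p : T =>
    isoHalf p.1.unpair.1 p.1.unpair.2 p.2.1.1 p.2.1.2 p.2.2.1.1 p.2.2.1.2 p.2.2.2.1.1 p.2.2.2.1.2 &&
      isoHalf p.1.unpair.2 p.1.unpair.1 p.2.1.2 p.2.1.1 p.2.2.1.1 p.2.2.1.2 p.2.2.2.2.1 p.2.2.2.2.2)
    (Primrec.and.comp
      (primrec_isoHalf he he' (Primrec.fst.comp hx) (Primrec.snd.comp hx) (Primrec.fst.comp hy)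
        (Primrec.snd.comp hy) (Primrec.fst.comp (Primrec.fst.comp hz))
        (Primrec.snd.comp (Primrec.fst.comp hz)))
      (primrec_isoHalf he' he (Primrec.snd.comp hx) (Primrec.fst.comp hx) (Primrec.fst.comp hy)
        (Primrec.snd.comp hy) (Primrec.fst.comp (Primrec.snd.comp hz))
        (Primrec.snd.comp (Primrec.snd.comp hz)))).to_comp fun n => ?_
  refine groupIso6_iff.trans ?_
  simp only [Prod.exists, Prod.forall]

theorem equivalence_groupIso6 : Equivalence GroupIso6 :=
  ⟨fun _ => ⟨MulEquiv.refl _⟩, fun ⟨φ⟩ => ⟨φ.symm⟩, fun ⟨φ⟩ ⟨ψ⟩ => ⟨φ.trans ψ⟩⟩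

section satisfies
variable {G : Type*} [Group G]

/-- The conjugate `t^q w t^{-q}`. -/
def conjPow (t w : G) (q : ℤ) : G := t ^ q * w * t ^ (-q)

/-- The element of a group described by `markWord`. -/
def markElt (t w : G) (n l : ℕ) : G :=
  conjPow t w (4 ^ l) * conjPow t w (-(Nat.pair l n + 1)) ^ 2

/-- The element of a group described by `edgeWord`. -/
def edgeElt (t w : G) (l e : ℕ) : G :=
  conjPow t w (4 ^ l + 2 * 4 ^ e) * (conjPow t w (-(Nat.pair l e.unpair.1 + 1)) *
    conjPow t w (-(Nat.pair l e.unpair.2.unpair.1 + 1)))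

/-- The relations of the `n`-th presentation, where `Q e l` says that the edge `e` is present
at level `l`. -/
structure Satisfies (Q : ℕ → ℕ → Prop) (n : ℕ) (t w u : G) : Prop where
  base_pow : w ^ 4 = 1
  base_comm : ∀ a : ℕ, Commute w (conjPow t w a)
  mark_pow : u ^ 3 = 1
  mark_comm : ∀ l, Commute u (markElt t w n l)
  edge_comm : ∀ l e, Q e l → Commute u (edgeElt t w l e ^ 2)

theorem map_mk_shiftWord (f : FreeGroup (Fin 6) →* G) (b : Bool) (n : ℕ) :
    f (FreeGroup.mk (shiftWord b n)) =
      f (FreeGroup.of 0) ^ (bif b then (n : ℤ) else -(n : ℤ)) := by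
  have h : ∀ n, FreeGroup.mk (shiftWord b n) =
      (FreeGroup.of (0 : Fin 6)) ^ (bif b then (n : ℤ) else -(n : ℤ)) := by
    intro n
    induction n with
    | zero => cases b <;> rfl
    | succ n ih =>
      have : shiftWord b (n + 1) = [(0, b)] ++ shiftWord b n := rfl
      rw [this, ← FreeGroup.mul_mk, ih]
      cases b
      · have h0 : FreeGroup.mk [((0 : Fin 6), false)] = (FreeGroup.of 0)⁻¹ := rfl
        rw [h0]
        simp only [cond_false]
        rw [← zpow_neg_one, ← zpow_add]
        congr 1; push_cast; ring
      · have h0 : FreeGroup.mk [((0 : Fin 6), true)] = FreeGroup.of 0 := rfl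
        rw [h0]
        simp only [cond_true]
        rw [← zpow_one_add]
        congr 1; push_cast; ring
  rw [h, map_zpow]

theorem map_mk_baseWord (f : FreeGroup (Fin 6) →* G) (b : Bool) (n : ℕ) :
    f (FreeGroup.mk (baseWord b n)) = conjPow (f (FreeGroup.of 0)) (f (FreeGroup.of 1))
      (bif b then (n : ℤ) else -(n : ℤ)) := by
  have h : FreeGroup.mk (baseWord b n) = FreeGroup.mk (shiftWord b n) *
      (FreeGroup.of 1 * FreeGroup.mk (shiftWord (!b) n)) := rfl
  rw [h, map_mul, map_mul, map_mk_shiftWord, map_mk_shiftWord, ← mul_assoc, conjPow]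
  cases b <;> simp

theorem map_mk_markWord (f : FreeGroup (Fin 6) →* G) (n l : ℕ) :
    f (FreeGroup.mk (markWord n l)) =
      markElt (f (FreeGroup.of 0)) (f (FreeGroup.of 1)) n l := by
  simp only [markWord, markElt, ← FreeGroup.mul_mk, map_mul, map_mk_baseWord, pow_two]
  simp

theorem map_mk_edgeWord (f : FreeGroup (Fin 6) →* G) (l e : ℕ) :
    f (FreeGroup.mk (edgeWord l e)) =
      edgeElt (f (FreeGroup.of 0)) (f (FreeGroup.of 1)) l e := by
  simp only [edgeWord, edgeElt, ← FreeGroup.mul_mk, map_mul, map_mk_baseWord]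
  simp

theorem map_mk_commWord_eq_one_iff (f : FreeGroup (Fin 6) →* G) (u v : List Letter) :
    f (FreeGroup.mk (commWord u v)) = 1 ↔ Commute (f (FreeGroup.mk u)) (f (FreeGroup.mk v)) := by
  simp only [commWord, ← FreeGroup.mul_mk, map_mul, ← FreeGroup.inv_mk, map_inv]
  rw [← mul_assoc, ← mul_inv_rev, mul_inv_eq_one]
  rfl

theorem map_mk_replicate (f : FreeGroup (Fin 6) →* G) (k : ℕ) (i : Fin 6) :
    f (FreeGroup.mk (List.replicate k (i, true))) = f (FreeGroup.of i) ^ k := by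
  induction k with
  | zero => exact (map_one f).trans (pow_zero _).symm
  | succ k ih =>
    have : FreeGroup.mk (List.replicate (k + 1) (i, true)) =
        FreeGroup.of i * FreeGroup.mk (List.replicate k (i, true)) := rfl
    rw [this, map_mul, ih, pow_succ']

theorem map_stagedRelWord_eq_one_iff (good : ℕ → ℕ → ℕ → Bool) (n : ℕ)
    (f : FreeGroup (Fin 6) →* G) :
    (∀ k, f (FreeGroup.mk (stagedRelWord good n k)) = 1) ↔
      Satisfies (fun e l => ∃ s, good e l s = true) n
        (f (FreeGroup.of 0)) (f (FreeGroup.of 1)) (f (FreeGroup.of 2)) ∧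
      f (FreeGroup.of 3) = 1 ∧ f (FreeGroup.of 4) = 1 ∧ f (FreeGroup.of 5) = 1 := by
  have h₁ : ∀ v, f (FreeGroup.mk (commWord [(1, true)] v)) = 1 ↔
    Commute (f (FreeGroup.of 1)) (f (FreeGroup.mk v)) := map_mk_commWord_eq_one_iff f _
  have h₂ : ∀ v, f (FreeGroup.mk (commWord [(2, true)] v)) = 1 ↔
    Commute (f (FreeGroup.of 2)) (f (FreeGroup.mk v)) := map_mk_commWord_eq_one_iff f _
  have hsq : ∀ l e, f (FreeGroup.mk (edgeWord l e ++ edgeWord l e)) =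
      edgeElt (f (FreeGroup.of 0)) (f (FreeGroup.of 1)) l e ^ 2 := by
    intro l e
    rw [← FreeGroup.mul_mk, map_mul, map_mk_edgeWord, pow_two]
  constructor
  · intro h
    refine ⟨⟨?_, fun a => ?_, ?_, fun l => ?_, ?_⟩, ?_, ?_, ?_⟩
    · have := h (Nat.pair 0 0)
      simp only [stagedRelWord, relWord, Nat.unpair_pair] at this
      exact (map_mk_replicate f 4 1).symm.trans this
    · have := h (Nat.pair 1 a)
      simp only [stagedRelWord, relWord, Nat.unpair_pair] at this
      simpa [map_mk_baseWord] using (h₁ _).1 this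
    · have := h (Nat.pair 2 0)
      simp only [stagedRelWord, relWord, Nat.unpair_pair] at this
      exact (map_mk_replicate f 3 2).symm.trans this
    · have := h (Nat.pair 3 l)
      simp only [stagedRelWord, relWord, Nat.unpair_pair] at this
      simpa [map_mk_markWord] using (h₂ _).1 this
    · rintro l e ⟨s, hs⟩
      have := h (Nat.pair 7 (Nat.pair l (Nat.pair e s)))
      simp only [stagedRelWord, relWord, Nat.unpair_pair, hs] at this
      exact hsq l e ▸ (h₂ _).1 this
    · have := h (Nat.pair 4 0)
      simp only [stagedRelWord, relWord, Nat.unpair_pair] at this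
      exact this
    · have := h (Nat.pair 5 0)
      simp only [stagedRelWord, relWord, Nat.unpair_pair] at this
      exact this
    · have := h (Nat.pair 6 0)
      simp only [stagedRelWord, relWord, Nat.unpair_pair] at this
      exact this
  · rintro ⟨hS, h3, h4, h5⟩ k
    obtain ⟨i, a, rfl⟩ : ∃ i a, k = Nat.pair i a := ⟨_, _, (Nat.pair_unpair k).symm⟩
    simp only [stagedRelWord, relWord, Nat.unpair_pair]
    match i with
    | 0 => exact (map_mk_replicate f 4 1).trans hS.base_pow
    | 1 => exact (h₁ _).2 (by simpa [map_mk_baseWord] using hS.base_comm a)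
    | 2 => exact (map_mk_replicate f 3 2).trans hS.mark_pow
    | 3 => exact (h₂ _).2 (by simpa [map_mk_markWord] using hS.mark_comm a)
    | 4 => exact h3
    | 5 => exact h4
    | 6 => exact h5
    | i + 7 =>
      cases hg : good a.unpair.2.unpair.1 a.unpair.1 a.unpair.2.unpair.2
      · simp only [Bool.not_false, Bool.and_true]
        rw [decide_eq_true (by omega)]
        exact map_one f
      · simp only [Bool.not_true, Bool.and_false, cond_false]
        exact (h₂ _).2 (hsq _ _ ▸ hS.edge_comm _ _ ⟨_, hg⟩)

end satisfies

section transvection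
universe u
variable {G : Type u} [Group G]

theorem conjPow_conjPow (t w : G) (p q : ℤ) :
    conjPow t (conjPow t w p) q = conjPow t w (q + p) := by
  simp only [conjPow, neg_add, zpow_add]
  group

theorem conjPow_mul (t v w : G) (q : ℤ) :
    conjPow t (v * w) q = conjPow t v q * conjPow t w q := by
  simp only [conjPow]
  group

theorem conjPow_pow (t w : G) (q : ℤ) (k : ℕ) : conjPow t (w ^ k) q = conjPow t w q ^ k := by
  simp only [conjPow, zpow_neg, conj_pow]

theorem conjPow_zero (t w : G) : conjPow t w 0 = w := by simp [conjPow]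

theorem Commute.conjPow {t v w : G} (h : Commute v w) (q : ℤ) :
    Commute (conjPow t v q) (conjPow t w q) := by
  rw [commute_iff_eq, ← conjPow_mul, ← conjPow_mul, h.eq]

namespace Satisfies

variable {Q : ℕ → ℕ → Prop} {n m : ℕ} {t w u : G}

theorem conjPow_pow_four (h : Satisfies Q n t w u) (q : ℤ) : conjPow t w q ^ 4 = 1 := by
  rw [← conjPow_pow, h.base_pow]
  simp [conjPow]

theorem commute_conjPow (h : Satisfies Q n t w u) (p q : ℤ) :
    Commute (conjPow t w p) (conjPow t w q) := by
  have key : ∀ p (a : ℕ), Commute (conjPow t w p) (conjPow t w (p + a)) := fun p a => by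
    rw [← conjPow_conjPow]
    exact (h.base_comm a).conjPow p
  rcases le_total p q with hpq | hpq
  · obtain ⟨a, rfl⟩ := Int.le.dest hpq
    exact key p a
  · obtain ⟨a, rfl⟩ := Int.le.dest hpq
    exact (key q a).symm

/-- The conjugates of `w` commute, so identities between them can be checked in
commutative groups. -/
theorem exists_lift (h : Satisfies Q n t w u) :
    ∃ (A : Type u) (_ : CommGroup A) (f : A →* G) (c : ℤ → A),
      (∀ q, f (c q) = conjPow t w q) ∧ ∀ q, c q ^ 4 = 1 := by
  let k : Set G := Set.range (conjPow t w)
  have hk : ∀ x ∈ k, ∀ y ∈ k, x * y = y * x := by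
    rintro _ ⟨p, rfl⟩ _ ⟨q, rfl⟩
    exact h.commute_conjPow p q
  let c : ℤ → Subgroup.closure k := fun q => ⟨conjPow t w q, Subgroup.subset_closure ⟨q, rfl⟩⟩
  exact ⟨Subgroup.closure k, { mul_comm := (Subgroup.isMulCommutative_closure hk).is_comm.comm }, (Subgroup.closure k).subtype, c,
    fun q => rfl, fun q => Subtype.ext (h.conjPow_pow_four q)⟩

end Satisfies

theorem transvection_mark {A : Type*} [CommGroup A] {a b c d e : A} (hd : d ^ 4 = 1)
    (he : e ^ 4 = 1) : a * b ^ 2 * (c * d ^ 2) ^ 2 = a * e ^ 2 * (b * (c * e)) ^ 2 := by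
  have h : a * b ^ 2 * (c * d ^ 2) ^ 2 * e ^ 4 = a * e ^ 2 * (b * (c * e)) ^ 2 * d ^ 4 := by
    simp only [mul_pow, ← pow_mul]
    rw [show e ^ 4 = e ^ 2 * e ^ 2 by rw [← pow_add], show 2 * 2 = 4 from rfl]
    simp only [mul_comm, mul_left_comm, mul_assoc]
  simpa [hd, he] using h

theorem transvection_edge {A : Type*} [CommGroup A] {a b c a' b' c' : A} (ha : a' ^ 4 = 1)
    (hb : b' ^ 4 = 1) (hc : c' ^ 4 = 1) :
    (a * a' ^ 2 * (b * b' ^ 2 * (c * c' ^ 2))) ^ 2 = (a * (b * c)) ^ 2 := by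
  simp only [mul_pow, ← pow_mul, Nat.reduceMul, ha, hb, hc, mul_one]

/-- The transvection attached to an edge which is present at all levels and joins `n` and `m`
transforms solutions of the `m`-th system of relations into solutions of the `n`-th. -/
theorem Satisfies.transvection {Q : ℕ → ℕ → Prop} {n m e : ℕ} {t w u : G}
    (h : Satisfies Q m t w u) (he : ∀ l, Q e l)
    (hnm : (e.unpair.1 = n ∧ e.unpair.2.unpair.1 = m) ∨
      (e.unpair.1 = m ∧ e.unpair.2.unpair.1 = n)) :
    Satisfies Q n t (w * conjPow t w (2 * 4 ^ e) ^ 2) u ∧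
      w * conjPow t w (2 * 4 ^ e) ^ 2 *
        conjPow t (w * conjPow t w (2 * 4 ^ e) ^ 2) (2 * 4 ^ e) ^ 2 = w := by
  obtain ⟨A, _, f, c, hf, hc⟩ := h.exists_lift
  set s : ℤ := 2 * 4 ^ e
  have hw : w = f (c 0) := by rw [hf, conjPow_zero]
  have hconj : ∀ q, conjPow t (w * conjPow t w s ^ 2) q = f (c q * c (q + s) ^ 2) := by
    intro q
    rw [conjPow_mul, conjPow_pow, conjPow_conjPow, map_mul, map_pow, hf, hf]
  have hw' : w * conjPow t w s ^ 2 = f (c 0 * c s ^ 2) := by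
    rw [← conjPow_zero t (w * _), hconj, zero_add]
  have hcomm : ∀ x y, Commute (f x) (f y) := fun x y => (Commute.all x y).map f
  refine ⟨⟨?_, fun a => ?_, h.mark_pow, fun l => ?_, fun l e' hQ => ?_⟩, ?_⟩
  · rw [hw', ← map_pow, mul_pow, ← pow_mul, mul_comm 2 4, pow_mul, hc, hc, one_pow, one_mul,
      map_one]
  · rw [hw', ← hw', hconj, hw']
    exact hcomm _ _
  · have h₁ := h.mark_comm l
    have h₂ := h.edge_comm l e (he l)
    have key : markElt t (w * conjPow t w s ^ 2) n l = markElt t w m l * edgeElt t w l e ^ 2 := by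
      simp only [markElt, edgeElt, hconj]
      simp only [← hf, ← map_mul, ← map_pow]
      congr 1
      rcases hnm with ⟨hn, hm⟩ | ⟨hm, hn⟩
      · rw [hn, hm]
        exact transvection_mark (hc _) (hc _)
      · rw [hn, hm, mul_comm (c (-(_ + 1))) (c (-(_ + 1)))]
        exact transvection_mark (hc _) (hc _)
    rw [key]
    exact h₁.mul_right h₂
  · have key : edgeElt t (w * conjPow t w s ^ 2) l e' ^ 2 = edgeElt t w l e' ^ 2 := by
      simp only [edgeElt, hconj]
      simp only [← hf, ← map_mul, ← map_pow]
      congr 1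
      exact transvection_edge (hc _) (hc _) (hc _)
    rw [key]
    exact h.edge_comm l e' hQ
  · rw [hconj, hw', ← map_pow, ← map_mul, hw]
    congr 1
    rw [mul_pow, ← pow_mul, hc, mul_one, mul_assoc, ← pow_add, hc, mul_one]

/-- Presentations joined by an edge which is present at all levels are isomorphic. -/
theorem nonempty_mulEquiv_of_edge {good : ℕ → ℕ → ℕ → Bool} {n m e : ℕ}
    (he : ∀ l, ∃ s, good e l s = true)
    (h₁ : e.unpair.1 = n) (h₂ : e.unpair.2.unpair.1 = m) :
    Nonempty (PresentedGroup (Set.range fun k => FreeGroup.mk (stagedRelWord good n k)) ≃*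
      PresentedGroup (Set.range fun k => FreeGroup.mk (stagedRelWord good m k))) := by
  let P : ℕ → Type := fun n =>
    PresentedGroup (Set.range fun k => FreeGroup.mk (stagedRelWord good n k))
  have hstd : ∀ n, Satisfies (fun e l => ∃ s, good e l s = true) n (PresentedGroup.of 0 : P n)
      (PresentedGroup.of 1) (PresentedGroup.of 2) ∧ (PresentedGroup.of 3 : P n) = 1 ∧
      (PresentedGroup.of 4 : P n) = 1 ∧ (PresentedGroup.of 5 : P n) = 1 := fun n =>
    (map_stagedRelWord_eq_one_iff good n (PresentedGroup.mk _)).1 fun k =>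
      PresentedGroup.mk_eq_one_iff.2 (Subgroup.subset_normalClosure ⟨k, rfl⟩)
  let v : ∀ m, P m := fun m =>
    PresentedGroup.of 1 * conjPow (PresentedGroup.of 0) (PresentedGroup.of 1) (2 * 4 ^ e) ^ 2
  have hom : ∀ n m, ((e.unpair.1 = n ∧ e.unpair.2.unpair.1 = m) ∨
      (e.unpair.1 = m ∧ e.unpair.2.unpair.1 = n)) → ∃ φ : P n →* P m,
      φ (PresentedGroup.of 0) = PresentedGroup.of 0 ∧ φ (PresentedGroup.of 1) = v m ∧
      φ (PresentedGroup.of 2) = PresentedGroup.of 2 ∧ φ (PresentedGroup.of 3) = 1 ∧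
      φ (PresentedGroup.of 4) = 1 ∧ φ (PresentedGroup.of 5) = 1 := by
    intro n m hnm
    let g : Fin 6 → P m := ![PresentedGroup.of 0, v m, PresentedGroup.of 2, 1, 1, 1]
    have hg : ∀ r ∈ Set.range fun k => FreeGroup.mk (stagedRelWord good n k),
        FreeGroup.lift g r = 1 := by
      rintro _ ⟨k, rfl⟩
      refine (map_stagedRelWord_eq_one_iff good n (FreeGroup.lift g)).2 ⟨?_, ?_, ?_, ?_⟩ k
      · simp only [FreeGroup.lift_apply_of]
        exact ((hstd m).1.transvection he hnm).1
      all_goals simp [g]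
    exact ⟨PresentedGroup.toGroup hg, PresentedGroup.toGroup.of hg, PresentedGroup.toGroup.of hg,
      PresentedGroup.toGroup.of hg, PresentedGroup.toGroup.of hg, PresentedGroup.toGroup.of hg,
      PresentedGroup.toGroup.of hg⟩
  have inv : ∀ n m, ((e.unpair.1 = n ∧ e.unpair.2.unpair.1 = m) ∨
      (e.unpair.1 = m ∧ e.unpair.2.unpair.1 = n)) → ∀ (φ : P n →* P m) (ψ : P m →* P n),
      (φ (PresentedGroup.of 0) = PresentedGroup.of 0 ∧ φ (PresentedGroup.of 1) = v m ∧
        φ (PresentedGroup.of 2) = PresentedGroup.of 2 ∧ φ (PresentedGroup.of 3) = 1 ∧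
        φ (PresentedGroup.of 4) = 1 ∧ φ (PresentedGroup.of 5) = 1) →
      (ψ (PresentedGroup.of 0) = PresentedGroup.of 0 ∧ ψ (PresentedGroup.of 1) = v n ∧
        ψ (PresentedGroup.of 2) = PresentedGroup.of 2 ∧ ψ (PresentedGroup.of 3) = 1 ∧
        ψ (PresentedGroup.of 4) = 1 ∧ ψ (PresentedGroup.of 5) = 1) → ∀ x, ψ (φ x) = x := by
    rintro n m hnm φ ψ ⟨a0, a1, a2, a3, a4, a5⟩ ⟨b0, b1, b2, b3, b4, b5⟩ x
    refine DFunLike.congr_fun (f := ψ.comp φ) (g := MonoidHom.id (P n))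
      (PresentedGroup.ext fun i => ?_) x
    rw [MonoidHom.comp_apply]
    obtain ⟨h3, h4, h5⟩ := (hstd n).2
    fin_cases i
    · exact (congrArg ψ a0).trans b0
    · refine (congrArg ψ a1).trans ?_
      simp only [v, map_mul, map_pow, conjPow, map_zpow, b0, b1]
      exact ((hstd n).1.transvection (n := m) he hnm.symm).2
    · exact (congrArg ψ a2).trans b2
    · exact (congrArg ψ a3).trans ((map_one ψ).trans h3.symm)
    · exact (congrArg ψ a4).trans ((map_one ψ).trans h4.symm)
    · exact (congrArg ψ a5).trans ((map_one ψ).trans h5.symm)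
  obtain ⟨φ, hφ⟩ := hom n m (Or.inl ⟨h₁, h₂⟩)
  obtain ⟨ψ, hψ⟩ := hom m n (Or.inr ⟨h₁, h₂⟩)
  exact ⟨MulEquiv.mk' ⟨φ, ψ, inv n m (Or.inl ⟨h₁, h₂⟩) φ ψ hφ hψ,
    inv m n (Or.inr ⟨h₁, h₂⟩) ψ φ hψ hφ⟩ fun x y => map_mul φ x y⟩

end transvection

section laurent
open LaurentPolynomial

theorem exists_eq_T_of_isUnit {K : Type*} [Field K] {p : K[T;T⁻¹]} (hp : IsUnit p) :
    ∃ (c : K) (j : ℤ), p = C c * T j := by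
  obtain ⟨q, hpq⟩ := hp.exists_right_inv
  obtain ⟨a, p', hp'⟩ := exists_T_pow p
  obtain ⟨b, q', hq'⟩ := exists_T_pow q
  have h : p' * q' = Polynomial.X ^ (a + b) := by
    apply Polynomial.toLaurent_injective
    rw [map_mul, hp', hq', Polynomial.toLaurent_X_pow, Nat.cast_add, T_add]
    calc p * T a * (q * T b) = (p * q) * (T a * T b) := by ring
      _ = _ := by rw [hpq, one_mul]
  obtain ⟨i, -, u, hu⟩ := (dvd_prime_pow Polynomial.prime_X _).1 (Dvd.intro _ h)
  obtain ⟨c, -, hc⟩ := Polynomial.isUnit_iff.1 (u⁻¹).isUnit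
  have hp'' : p' = Polynomial.C c * Polynomial.X ^ i := by
    rw [hc, ← hu, mul_comm, mul_assoc, Units.mul_inv, mul_one]
  refine ⟨c, i - a, ?_⟩
  have : p = p * T a * T (-a) := by rw [mul_T_assoc, add_neg_cancel, T_zero, mul_one]
  rw [this, ← hp', hp'', Polynomial.toLaurent_C_mul_X_pow, mul_T_assoc, sub_eq_add_neg]

end laurent

section wreath

/-- The permutational wreath product of `ZMod 3` with a group `G` acting on a set `X`. -/
@[ext] structure PermWreath (G X : Type*) where
  lamp : X →₀ ZMod 3
  move : G

namespace PermWreath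

variable {G X : Type*} [Group G]

instance : One (PermWreath G X) := ⟨⟨0, 1⟩⟩

@[simp] theorem lamp_one : (1 : PermWreath G X).lamp = 0 := rfl
@[simp] theorem move_one : (1 : PermWreath G X).move = 1 := rfl

/-- The lamp at `x` is on, the others are off. -/
noncomputable def light (x : X) : PermWreath G X := ⟨Finsupp.single x 1, 1⟩

theorem light_ne_one (x : X) : (light x : PermWreath G X) ≠ 1 := fun h => by
  have := congrArg lamp h
  simp [light] at this

variable [MulAction G X]

attribute [local instance] Finsupp.comapSMul Finsupp.comapMulAction Finsupp.comapDistribMulAction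

noncomputable instance : Mul (PermWreath G X) := ⟨fun a b => ⟨a.lamp + a.move • b.lamp, a.move * b.move⟩⟩
noncomputable instance : Inv (PermWreath G X) := ⟨fun a => ⟨-(a.move⁻¹ • a.lamp), a.move⁻¹⟩⟩

@[simp] theorem lamp_mul (a b : PermWreath G X) :
    (a * b).lamp = a.lamp + a.move • b.lamp := rfl
@[simp] theorem move_mul (a b : PermWreath G X) : (a * b).move = a.move * b.move := rfl
@[simp] theorem lamp_inv (a : PermWreath G X) : a⁻¹.lamp = -(a.move⁻¹ • a.lamp) := rfl
@[simp] theorem move_inv (a : PermWreath G X) : a⁻¹.move = a.move⁻¹ := rfl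

noncomputable instance : Group (PermWreath G X) :=
  Group.ofLeftAxioms
    (fun a b c => by ext1 <;> simp [mul_assoc, mul_smul, add_assoc])
    (fun a => by ext1 <;> simp)
    (fun a => by ext1 <;> simp)

/-- The projection of the wreath product onto the acting group. -/
def moveHom : PermWreath G X →* G where
  toFun := move
  map_one' := rfl
  map_mul' _ _ := rfl

/-- The embedding of the acting group into the wreath product. -/
def inr : G →* PermWreath G X where
  toFun g := ⟨0, g⟩
  map_one' := rfl
  map_mul' a b := by ext1 <;> simp

theorem smul_lamp_of_commute {u v : PermWreath G X} (hu : u.move = 1) (h : Commute u v) :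
    v.move • u.lamp = u.lamp := by
  have := congrArg lamp h.eq
  rw [lamp_mul, lamp_mul, hu, one_smul, add_comm, add_left_cancel_iff] at this
  exact this.symm

theorem light_pow_three (x : X) : (light x : PermWreath G X) ^ 3 = 1 := by
  rw [pow_succ, pow_two]
  ext1
  · simp only [light, lamp_mul, move_mul, one_smul, mul_one, lamp_one, ← Finsupp.single_add]
    rw [show (1 + 1 + 1 : ZMod 3) = 0 by decide, Finsupp.single_zero]
  · simp [light]

theorem commute_light_inr {x : X} {g : G} (h : g • x = x) :
    Commute (light x : PermWreath G X) (inr g) := by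
  ext1
  · simp [light, inr, Finsupp.comapSMul_single, h]
  · simp [light, inr]

theorem smul_mem_support {F : X →₀ ZMod 3} {g : G} (h : g • F = F) {x : X} (hx : x ∈ F.support) :
    g • x ∈ F.support := by
  rw [Finsupp.mem_support_iff] at hx ⊢
  rw [← h, Finsupp.comapSMul_apply, inv_smul_smul]
  exact hx

/-- Commuting with a lamp configuration preserves its support. -/
theorem smul_mem_support_of_commute {u v : PermWreath G X} (hu : u.move = 1) (h : Commute u v)
    {x : X} (hx : x ∈ u.lamp.support) : v.move • x ∈ u.lamp.support :=
  smul_mem_support (smul_lamp_of_commute hu h) hx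

end PermWreath

end wreath

section lamplighter
open LaurentPolynomial

/-- The lamplighter group over `ZMod 4`. -/
@[ext] structure Lamplighter where
  base : (ZMod 4)[T;T⁻¹]
  shift : ℤ

namespace Lamplighter

noncomputable instance : Mul Lamplighter :=
  ⟨fun a b => ⟨a.base + T a.shift * b.base, a.shift + b.shift⟩⟩
noncomputable instance : One Lamplighter := ⟨⟨0, 0⟩⟩
noncomputable instance : Inv Lamplighter := ⟨fun a => ⟨-(T (-a.shift) * a.base), -a.shift⟩⟩

@[simp] theorem base_mul (a b : Lamplighter) : (a * b).base = a.base + T a.shift * b.base := rfl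
@[simp] theorem shift_mul (a b : Lamplighter) : (a * b).shift = a.shift + b.shift := rfl
@[simp] theorem base_one : (1 : Lamplighter).base = 0 := rfl
@[simp] theorem shift_one : (1 : Lamplighter).shift = 0 := rfl
@[simp] theorem base_inv (a : Lamplighter) : a⁻¹.base = -(T (-a.shift) * a.base) := rfl
@[simp] theorem shift_inv (a : Lamplighter) : a⁻¹.shift = -a.shift := rfl

noncomputable instance : Group Lamplighter :=
  Group.ofLeftAxioms
    (fun a b c => by ext1 <;> simp only [base_mul, shift_mul, T_add] <;> ring)
    (fun a => by ext1 <;> simp)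
    (fun a => by ext1 <;> simp)

@[simp] theorem shift_zpow (a : Lamplighter) (k : ℤ) : (a ^ k).shift = k * a.shift := by
  let f : Lamplighter →* Multiplicative ℤ :=
    { toFun := fun a => Multiplicative.ofAdd a.shift
      map_one' := rfl
      map_mul' := fun _ _ => rfl }
  have := map_zpow f a k
  exact (congrArg Multiplicative.toAdd this).trans (smul_eq_mul ..)

@[simp] theorem shift_pow (a : Lamplighter) (k : ℕ) : (a ^ k).shift = k * a.shift := by
  simpa using shift_zpow a k

theorem base_pow {a : Lamplighter} (h : a.shift = 0) (k : ℕ) : (a ^ k).base = k * a.base := by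
  induction k with
  | zero => simp
  | succ k ih => rw [pow_succ, base_mul, ih, shift_pow, h]; simp; ring

theorem shift_conjPow (t : Lamplighter) {w : Lamplighter} (hw : w.shift = 0) (q : ℤ) :
    (conjPow t w q).shift = 0 := by
  simp [conjPow, hw]

theorem base_conjPow (t : Lamplighter) {w : Lamplighter} (hw : w.shift = 0) (q : ℤ) :
    (conjPow t w q).base = T (q * t.shift) * w.base := by
  have h : (t ^ q * t ^ (-q)).base = 0 := by simp
  rw [base_mul] at h
  rw [conjPow, base_mul, base_mul, shift_mul, hw, add_zero]
  rw [shift_zpow] at *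
  linear_combination h

/-- Pairs of a lamp configuration modulo `D`, seen from a position, and that position. -/
def Cosets (D : AddSubgroup (ZMod 4)[T;T⁻¹]) : Type := ((ZMod 4)[T;T⁻¹] ⧸ D) × ℤ

noncomputable instance (D : AddSubgroup (ZMod 4)[T;T⁻¹]) : MulAction Lamplighter (Cosets D) where
  smul g c := (c.1 + QuotientAddGroup.mk (T (-(g.shift + c.2)) * g.base), g.shift + c.2)
  one_smul c := by
    change ((_, _) : ((ZMod 4)[T;T⁻¹] ⧸ D) × ℤ) = (c.1, c.2)
    simp
  mul_smul a b c := by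
    change ((_, _) : ((ZMod 4)[T;T⁻¹] ⧸ D) × ℤ) = (_, _)
    refine Prod.ext ?_ (add_assoc a.shift b.shift c.2)
    change c.1 + QuotientAddGroup.mk _ =
      c.1 + QuotientAddGroup.mk (T (-(b.shift + c.2)) * b.base) +
        QuotientAddGroup.mk (T (-(a.shift + (b.shift + c.2))) * a.base)
    rw [add_assoc, ← QuotientAddGroup.mk_add]
    congr 2
    simp only [base_mul, shift_mul, mul_add, ← mul_assoc, ← T_add]
    rw [show -(a.shift + b.shift + c.2) + a.shift = -(b.shift + c.2) by ring, add_comm,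
      add_assoc a.shift]

theorem smul_def {D : AddSubgroup (ZMod 4)[T;T⁻¹]} (g : Lamplighter) (c : Cosets D) :
    g • c = (c.1 + QuotientAddGroup.mk (T (-(g.shift + c.2)) * g.base), g.shift + c.2) := rfl

theorem smul_eq_smul_iff {D : AddSubgroup (ZMod 4)[T;T⁻¹]} {g h : Lamplighter}
    (hg : g.shift = 0) (hh : h.shift = 0) (c : Cosets D) :
    g • c = h • c ↔ T (-c.2) * (h.base - g.base) ∈ D := by
  rw [smul_def, smul_def, hg, hh, zero_add]
  change ((_, _) : ((ZMod 4)[T;T⁻¹] ⧸ D) × ℤ) = (_, _) ↔ _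
  rw [Prod.mk.injEq, and_iff_left rfl, add_left_cancel_iff, QuotientAddGroup.eq, mul_sub,
    neg_add_eq_sub]

end Lamplighter

end lamplighter

section closure
variable {G H : Type*} [Group G] [Group H]

theorem map_conjPow (f : G →* H) (t w : G) (q : ℤ) :
    f (conjPow t w q) = conjPow (f t) (f w) q := by
  simp [conjPow]

theorem map_markElt (f : G →* H) (t w : G) (n l : ℕ) :
    f (markElt t w n l) = markElt (f t) (f w) n l := by
  simp only [markElt, map_mul, map_pow, map_conjPow]

theorem map_edgeElt (f : G →* H) (t w : G) (l e : ℕ) :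
    f (edgeElt t w l e) = edgeElt (f t) (f w) l e := by
  simp only [edgeElt, map_mul, map_conjPow]

theorem conjPow_mem_closure {t w b : G} (hb : b ∈ Subgroup.closure (Set.range (conjPow t w)))
    (k : ℤ) : conjPow t b k ∈ Subgroup.closure (Set.range (conjPow t w)) := by
  induction hb using Subgroup.closure_induction with
  | mem x hx =>
    obtain ⟨q, rfl⟩ := hx
    rw [conjPow_conjPow]
    exact Subgroup.subset_closure ⟨_, rfl⟩
  | one => simp [conjPow]
  | mul x y _ _ hx hy => rw [conjPow_mul]; exact mul_mem hx hy
  | inv x _ hx =>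
    have : conjPow t x⁻¹ k = (conjPow t x k)⁻¹ := by simp only [conjPow]; group
    rw [this]
    exact inv_mem hx

/-- An element of the subgroup generated by `t` and `w` is a product of conjugates of `w` by
powers of `t`, up to a power of `t`. -/
theorem exists_mul_zpow_of_mem_closure_pair {t w g : G} (hg : g ∈ Subgroup.closure {t, w}) :
    ∃ b ∈ Subgroup.closure (Set.range (conjPow t w)), ∃ k : ℤ, g = b * t ^ k := by
  induction hg using Subgroup.closure_induction with
  | mem x hx =>
    rcases hx with rfl | rfl
    · exact ⟨1, one_mem _, 1, by simp⟩
    · exact ⟨x, Subgroup.subset_closure ⟨0, conjPow_zero t x⟩, 0, by simp⟩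
  | one => exact ⟨1, one_mem _, 0, by simp⟩
  | mul x y _ _ hx hy =>
    obtain ⟨b, hb, k, rfl⟩ := hx
    obtain ⟨c, hc, l, rfl⟩ := hy
    exact ⟨_, mul_mem hb (conjPow_mem_closure hc k), k + l, by simp only [conjPow]; group⟩
  | inv x _ hx =>
    obtain ⟨b, hb, k, rfl⟩ := hx
    exact ⟨_, conjPow_mem_closure (inv_mem hb) (-k), -k, by simp only [conjPow]; group⟩

namespace Satisfies

variable {Q : ℕ → ℕ → Prop} {n : ℕ} {t w u : G}

theorem map (h : Satisfies Q n t w u) (f : G →* H) : Satisfies Q n (f t) (f w) (f u) where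
  base_pow := by rw [← map_pow, h.base_pow, map_one]
  base_comm a := by rw [← map_conjPow]; exact (h.base_comm a).map f
  mark_pow := by rw [← map_pow, h.mark_pow, map_one]
  mark_comm l := by rw [← map_markElt]; exact (h.mark_comm l).map f
  edge_comm l e he := by
    rw [← map_edgeElt, ← map_pow]; exact (h.edge_comm l e he).map f

theorem pow_four_of_mem_closure (h : Satisfies Q n t w u) {b : G}
    (hb : b ∈ Subgroup.closure (Set.range (conjPow t w))) : b ^ 4 = 1 := by
  obtain ⟨A, _, f, c, hc, hc4⟩ := h.exists_lift
  suffices ∃ a : A, a ^ 4 = 1 ∧ f a = b by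
    obtain ⟨a, ha, rfl⟩ := this
    rw [← map_pow, ha, map_one]
  induction hb using Subgroup.closure_induction with
  | mem x hx =>
    obtain ⟨q, rfl⟩ := hx
    exact ⟨c q, hc4 q, hc q⟩
  | one => exact ⟨1, one_pow _, map_one f⟩
  | mul x y _ _ hx hy =>
    obtain ⟨a, ha, rfl⟩ := hx
    obtain ⟨a', ha', rfl⟩ := hy
    exact ⟨a * a', by rw [mul_pow, ha, ha', one_mul], map_mul f a a'⟩
  | inv x _ hx =>
    obtain ⟨a, ha, rfl⟩ := hx
    exact ⟨a⁻¹, by rw [inv_pow, ha, inv_one], map_inv f a⟩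

end Satisfies

end closure

namespace Lamplighter
open LaurentPolynomial

variable {t w : Lamplighter}

theorem shift_eq_zero_of_pow {g : Lamplighter} {k : ℕ} (hk : k ≠ 0) (h : g ^ k = 1) :
    g.shift = 0 := by
  have := congrArg shift h
  rw [shift_pow, shift_one] at this
  exact (mul_eq_zero.1 this).resolve_left (Nat.cast_ne_zero.2 hk)

theorem shift_dvd_of_mem_closure (hw : w.shift = 0) {g : Lamplighter}
    (hg : g ∈ Subgroup.closure {t, w}) : t.shift ∣ g.shift := by
  induction hg using Subgroup.closure_induction with
  | mem x hx =>
    rcases hx with rfl | rfl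
    · rfl
    · rw [hw]; exact dvd_zero _
  | one => exact dvd_zero _
  | mul x y _ _ hx hy => exact dvd_add hx hy
  | inv x _ hx => exact (dvd_neg).2 hx

theorem of_mem_closure_conjPow (hw : w.shift = 0) {g : Lamplighter}
    (hg : g ∈ Subgroup.closure (Set.range (conjPow t w))) :
    g.shift = 0 ∧ w.base ∣ g.base := by
  induction hg using Subgroup.closure_induction with
  | mem x hx =>
    obtain ⟨q, rfl⟩ := hx
    exact ⟨shift_conjPow t hw q, base_conjPow t hw q ▸ Dvd.intro_left _ rfl⟩
  | one => exact ⟨rfl, dvd_zero _⟩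
  | mul x y _ _ hx hy =>
    exact ⟨by rw [shift_mul, hx.1, hy.1, add_zero], dvd_add hx.2 (hy.2.mul_left _)⟩
  | inv x _ hx =>
    exact ⟨by rw [shift_inv, hx.1, neg_zero], dvd_neg.2 (hx.2.mul_left _)⟩

/-- A pair generating the lamplighter group consists of a lamp configuration which is a unit
and an element which shifts by one. -/
theorem shift_and_isUnit_of_mem_closure (hw : w.shift = 0)
    (h₁ : (⟨0, 1⟩ : Lamplighter) ∈ Subgroup.closure {t, w})
    (h₂ : (⟨1, 0⟩ : Lamplighter) ∈ Subgroup.closure {t, w}) :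
    (t.shift = 1 ∨ t.shift = -1) ∧ IsUnit w.base := by
  have ht := Int.isUnit_iff.1 (isUnit_of_dvd_one (shift_dvd_of_mem_closure hw h₁))
  refine ⟨ht, ?_⟩
  obtain ⟨b, hb, k, hk⟩ := exists_mul_zpow_of_mem_closure_pair h₂
  obtain ⟨hb₁, hb₂⟩ := of_mem_closure_conjPow hw hb
  have hk0 : k = 0 := by
    have := congrArg shift hk
    rw [shift_mul, hb₁, shift_zpow, zero_add] at this
    exact (mul_eq_zero.1 this.symm).resolve_right (by rcases ht with h | h <;> rw [h] <;> decide)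
  rw [hk0, zpow_zero, mul_one] at hk
  rw [← hk] at hb₂
  exact isUnit_of_dvd_one hb₂

theorem shift_markElt (hw : w.shift = 0) (n l : ℕ) : (markElt t w n l).shift = 0 := by
  rw [markElt, shift_mul, shift_pow, shift_conjPow _ hw, shift_conjPow _ hw]
  rfl

theorem base_markElt (hw : w.shift = 0) (n l : ℕ) : (markElt t w n l).base =
    (T (4 ^ l * t.shift) + 2 * T (-(Nat.pair l n + 1) * t.shift)) * w.base := by
  rw [markElt, base_mul, base_pow (shift_conjPow _ hw _), shift_conjPow _ hw,
    base_conjPow _ hw, base_conjPow _ hw, T_zero]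
  push_cast
  ring

theorem shift_edgeElt (hw : w.shift = 0) (l e : ℕ) : (edgeElt t w l e ^ 2).shift = 0 := by
  rw [edgeElt, shift_pow, shift_mul, shift_mul, shift_conjPow _ hw, shift_conjPow _ hw,
    shift_conjPow _ hw]
  rfl

theorem base_edgeElt (hw : w.shift = 0) (l e : ℕ) : (edgeElt t w l e ^ 2).base =
    2 * (T ((4 ^ l + 2 * 4 ^ e) * t.shift) + (T (-(Nat.pair l e.unpair.1 + 1) * t.shift) +
      T (-(Nat.pair l e.unpair.2.unpair.1 + 1) * t.shift))) * w.base := by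
  have h : (edgeElt t w l e).shift = 0 := by
    have := shift_edgeElt (t := t) hw l e
    rw [shift_pow] at this
    exact (mul_eq_zero.1 this).resolve_left (by decide)
  rw [base_pow h, edgeElt, base_mul, base_mul, shift_conjPow _ hw, shift_conjPow _ hw,
    base_conjPow _ hw, base_conjPow _ hw, base_conjPow _ hw, T_zero]
  push_cast
  ring

end Lamplighter

section halving
open LaurentPolynomial

/-- Reduction modulo two. -/
noncomputable def modTwo : (ZMod 4)[T;T⁻¹] →+* (ZMod 2)[T;T⁻¹] :=
  AddMonoidAlgebra.mapRingHom ℤ (ZMod.castHom (show 2 ∣ 4 by decide) (ZMod 2))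

theorem modTwo_T (j : ℤ) : modTwo (T j) = T j :=
  (AddMonoidAlgebra.mapRingHom_single ..).trans (by rw [map_one]; rfl)

theorem exists_eq_two_mul_of_modTwo_eq_zero {p : (ZMod 4)[T;T⁻¹]} (hp : modTwo p = 0) :
    ∃ f, p = 2 * f := by
  have key : ∀ a : ZMod 4, (a.cast : ZMod 2) = 0 → a = 2 * (if a = 2 then 1 else 0) := by decide
  refine ⟨.ofCoeff (p.coeff.mapRange (fun a : ZMod 4 => if a = 2 then 1 else 0) (by decide)), ?_⟩
  ext n
  rw [two_mul]
  have h : (modTwo p).coeff n = 0 := by rw [hp]; rfl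
  rw [modTwo, AddMonoidAlgebra.coeff_mapRingHom] at h
  have := key _ h
  rw [two_mul] at this
  exact this

/-- A unit of `(ZMod 4)[T;T⁻¹]` is a monomial modulo two. -/
theorem exists_eq_T_add_two_mul {p : (ZMod 4)[T;T⁻¹]} (hp : IsUnit p) :
    ∃ (j : ℤ) (f : (ZMod 4)[T;T⁻¹]), p = T j + 2 * f := by
  have key : ∀ c : ZMod 2, c ≠ 0 → c = 1 := by decide
  have : Fact (Nat.Prime 2) := ⟨Nat.prime_two⟩
  obtain ⟨c, j, hc⟩ := exists_eq_T_of_isUnit (hp.map modTwo)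
  have hc1 : c = 1 := by
    refine key c ?_
    rintro rfl
    rw [map_zero, zero_mul] at hc
    exact (hp.map modTwo).ne_zero hc
  rw [hc1, map_one, one_mul, ← modTwo_T, ← sub_eq_zero, ← map_sub] at hc
  obtain ⟨f, hf⟩ := exists_eq_two_mul_of_modTwo_eq_zero hc
  exact ⟨j, f, by rw [← hf]; ring⟩

end halving

section weight
open LaurentPolynomial

/-- The linear functional on Laurent polynomials with prescribed values on monomials. -/
noncomputable def weight (wt : ℤ → ZMod 4) : (ZMod 4)[T;T⁻¹] →ₗ[ZMod 4] ZMod 4 :=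
  Finsupp.linearCombination (ZMod 4) wt ∘ₗ
    (AddMonoidAlgebra.coeffLinearEquiv (ZMod 4)).toLinearMap

theorem weight_T (wt : ℤ → ZMod 4) (q : ℤ) : weight wt (T q) = wt q := by
  change Finsupp.linearCombination (ZMod 4) wt (Finsupp.single q 1) = _
  simp

theorem weight_C_mul_T (wt : ℤ → ZMod 4) (a : ZMod 4) (q : ℤ) :
    weight wt (C a * T q) = a * wt q := by
  rw [← smul_eq_C_mul, map_smul, weight_T, smul_eq_mul]

theorem weight_two_mul (wt : ℤ → ZMod 4) (p : (ZMod 4)[T;T⁻¹]) :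
    weight wt (2 * p) = 2 * weight wt p := by
  rw [two_mul, two_mul, map_add]

theorem two_mul_weight {wt : ℤ → ZMod 4} (h : ∀ q, 2 * wt q = 0) (p : (ZMod 4)[T;T⁻¹]) :
    2 * weight wt p = 0 := by
  induction p using LaurentPolynomial.induction_on' with
  | add p q hp hq => rw [map_add, mul_add, hp, hq, add_zero]
  | C_mul_T n a => rw [weight_C_mul_T, mul_left_comm, h, mul_zero]

open Filter in
theorem eventually_weight_eq_zero {wt : ℕ → ℤ → ZMod 4} (h : ∀ q, ∀ᶠ l in atTop, wt l q = 0)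
    (p : (ZMod 4)[T;T⁻¹]) : ∀ᶠ l in atTop, weight (wt l) p = 0 := by
  induction p using LaurentPolynomial.induction_on' with
  | add p q hp hq =>
    filter_upwards [hp, hq] with l h₁ h₂
    rw [map_add, h₁, h₂, add_zero]
  | C_mul_T n a =>
    filter_upwards [h n] with l hl
    rw [weight_C_mul_T, hl, mul_zero]

open Filter in
theorem eventually_two_mul_weight_mul_T_eq_zero {wt : ℕ → ℤ → ZMod 4} {c : ℕ → ℤ}
    (h : ∀ q, ∀ᶠ l in atTop, 2 * wt l (q + c l) = 0) (p : (ZMod 4)[T;T⁻¹]) :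
    ∀ᶠ l in atTop, 2 * weight (wt l) (p * T (c l)) = 0 := by
  induction p using LaurentPolynomial.induction_on' with
  | add p q hp hq =>
    filter_upwards [hp, hq] with l h₁ h₂
    rw [add_mul, map_add, mul_add, h₁, h₂, add_zero]
  | C_mul_T n a =>
    filter_upwards [h n] with l hl
    rw [mul_T_assoc, weight_C_mul_T, mul_left_comm, hl, mul_zero]

/-- The configuration of lamps marking the `n`-th presentation at level `l`. -/
noncomputable def markPoly (n l : ℕ) : (ZMod 4)[T;T⁻¹] :=
  T (4 ^ l) + 2 * T (-(Nat.pair l n + 1))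

/-- The configuration of lamps attached to the edge `e` at level `l`. -/
noncomputable def edgePoly (l e : ℕ) : (ZMod 4)[T;T⁻¹] :=
  2 * (T (4 ^ l + 2 * 4 ^ e) + (T (-(Nat.pair l e.unpair.1 + 1)) +
    T (-(Nat.pair l e.unpair.2.unpair.1 + 1))))

/-- The subgroup of configurations fixing the base point in the wreath product attached to the
`m`-th presentation. -/
noncomputable def stabilizerGroup (Q : ℕ → ℕ → Prop) (m : ℕ) : AddSubgroup (ZMod 4)[T;T⁻¹] :=
  AddSubgroup.closure ({x | ∃ l, x = markPoly m l} ∪ {x | ∃ l e, Q e l ∧ x = edgePoly l e})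

theorem weight_eq_zero_of_mem {Q : ℕ → ℕ → Prop} {m : ℕ} {wt : ℤ → ZMod 4}
    (h₁ : ∀ l, wt (4 ^ l) + 2 * wt (-(Nat.pair l m + 1)) = 0)
    (h₂ : ∀ l e, Q e l → 2 * (wt (4 ^ l + 2 * 4 ^ e) + (wt (-(Nat.pair l e.unpair.1 + 1)) +
      wt (-(Nat.pair l e.unpair.2.unpair.1 + 1)))) = 0)
    {x : (ZMod 4)[T;T⁻¹]} (hx : x ∈ stabilizerGroup Q m) : weight wt x = 0 := by
  induction hx using AddSubgroup.closure_induction with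
  | mem x hx =>
    rcases hx with ⟨l, rfl⟩ | ⟨l, e, he, rfl⟩
    · rw [markPoly, map_add, weight_two_mul, weight_T, weight_T, h₁]
    · rw [edgePoly, weight_two_mul, map_add, map_add, weight_T, weight_T, weight_T, h₂ l e he]
  | zero => exact map_zero _
  | add x y _ _ hx hy => rw [map_add, hx, hy, add_zero]
  | neg x _ hx => rw [map_neg, hx, neg_zero]

end weight

section positions

theorem pow_four_ne_edge (l k e : ℕ) : (4 : ℤ) ^ l ≠ 4 ^ k + 2 * 4 ^ e := fun h => by
  have h1 : ∀ n : ℕ, (4 : ℤ) ^ n ≡ 1 [ZMOD 3] := fun n => by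
    simpa using (show (4 : ℤ) ≡ 1 [ZMOD 3] by decide).pow n
  have h2 : (4 : ℤ) ^ k + 2 * 4 ^ e ≡ 1 + 2 * 1 [ZMOD 3] :=
    (h1 k).add ((h1 e).mul_left 2)
  rw [← h] at h2
  exact absurd ((h1 l).symm.trans h2) (by decide)

theorem edge_injective {l k e d : ℕ} (h : (4 : ℤ) ^ l + 2 * 4 ^ e = 4 ^ k + 2 * 4 ^ d) :
    l = k ∧ e = d := by
  have h' : ∑ i ∈ {2 * l, 2 * e + 1}, 2 ^ i = ∑ i ∈ {2 * k, 2 * d + 1}, 2 ^ i := by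
    rw [Finset.sum_pair (by omega), Finset.sum_pair (by omega), pow_succ, pow_succ, pow_mul,
      pow_mul, pow_mul, pow_mul]
    norm_num
    have : (4 : ℕ) ^ l + 2 * 4 ^ e = 4 ^ k + 2 * 4 ^ d := by exact_mod_cast h
    omega
  have hs := Finset.geomSum_injective (le_refl 2) h'
  have hl : 2 * l ∈ ({2 * k, 2 * d + 1} : Finset ℕ) := by rw [← hs]; simp
  have he : 2 * e + 1 ∈ ({2 * k, 2 * d + 1} : Finset ℕ) := by rw [← hs]; simp
  simp only [Finset.mem_insert, Finset.mem_singleton] at hl he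
  omega

theorem pow_four_injective {l k : ℕ} (h : (4 : ℤ) ^ l = 4 ^ k) : l = k :=
  Int.pow_right_injective (by decide) h

open Classical in
/-- The weight measuring the class `M` at level `l`. -/
noncomputable def levelWeight (Q : ℕ → ℕ → Prop) (M : ℕ → Prop) (l : ℕ) (q : ℤ) : ZMod 4 :=
  if q = 4 ^ l then 2
  else if ∃ e, q = 4 ^ l + 2 * 4 ^ e ∧ Q e l ∧ ¬(M e.unpair.1 ↔ M e.unpair.2.unpair.1) then 1
  else if ∃ c : ℕ, q = -(Nat.pair l c + 1) ∧ M c then 1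
  else 0

variable (Q : ℕ → ℕ → Prop) (M : ℕ → Prop) (l k e c : ℕ)

open Classical in
theorem levelWeight_pow : levelWeight Q M l (4 ^ k) = if k = l then 2 else 0 := by
  rw [levelWeight]
  split_ifs with h₁ h₂ h₃ h₄ h₅ h₆ h₇
  · rfl
  · exact absurd (pow_four_injective h₁) h₂
  · exact absurd (congrArg _ h₄) h₁
  · obtain ⟨e, he, -⟩ := h₃
    exact absurd he (pow_four_ne_edge _ _ _)
  · exact absurd (congrArg _ h₆) h₁
  · obtain ⟨c, hc, -⟩ := h₅
    have : (0 : ℤ) < 4 ^ k := by positivity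
    omega
  · subst k; exact absurd rfl h₁
  · rfl

open Classical in
theorem levelWeight_edge : levelWeight Q M l (4 ^ k + 2 * 4 ^ e) =
    if k = l ∧ Q e l ∧ ¬(M e.unpair.1 ↔ M e.unpair.2.unpair.1) then 1 else 0 := by
  rw [levelWeight, if_neg fun h => pow_four_ne_edge _ _ _ h.symm]
  congr 1
  · refine propext ⟨?_, fun h => ⟨e, by rw [h.1], h.2⟩⟩
    rintro ⟨d, hd, h⟩
    obtain ⟨rfl, rfl⟩ := edge_injective hd
    exact ⟨rfl, h⟩
  · refine if_neg ?_
    rintro ⟨c, hc, -⟩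
    have : (0 : ℤ) < 4 ^ k := by positivity
    have : (0 : ℤ) < 4 ^ e := by positivity
    omega

open Classical in
theorem levelWeight_neg : levelWeight Q M l (-(Nat.pair k c + 1)) =
    if k = l ∧ M c then 1 else 0 := by
  have h4 : ∀ n : ℕ, (0 : ℤ) < 4 ^ n := fun n => by positivity
  rw [levelWeight, if_neg fun h => by have := h4 l; omega, if_neg]
  · congr 1
    refine propext ⟨?_, fun h => ⟨c, by rw [h.1], h.2⟩⟩
    rintro ⟨d, hd, h⟩
    have : Nat.pair k c = Nat.pair l d := by omega
    obtain ⟨rfl, rfl⟩ := Nat.pair_eq_pair.1 this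
    exact ⟨rfl, h⟩
  · rintro ⟨d, hd, -⟩
    have := h4 l
    have := h4 d
    omega

variable {Q M}

theorem levelWeight_eq_zero_of_lt {q : ℤ} (h : |q| < l) : levelWeight Q M l q = 0 := by
  have h4 : (l : ℤ) < 4 ^ l := by exact_mod_cast Nat.lt_pow_self (by decide)
  have hq := abs_lt.1 h
  rw [levelWeight, if_neg (by omega), if_neg, if_neg]
  · rintro ⟨c, hc, -⟩
    have := Nat.left_le_pair l c
    omega
  · rintro ⟨e, he, -⟩
    have : (0 : ℤ) < 4 ^ e := by positivity
    omega

open Filter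

theorem eventually_levelWeight_eq_zero (q : ℤ) : ∀ᶠ l in atTop, levelWeight Q M l q = 0 := by
  filter_upwards [eventually_gt_atTop |q|.toNat] with l hl
  exact levelWeight_eq_zero_of_lt l (by have := abs_nonneg q; omega)

theorem eventually_two_mul_levelWeight_eq_zero
    (hQ : ∀ e l k, l ≤ k → Q e k → Q e l)
    (hM : ∀ e, (∀ l, Q e l) → (M e.unpair.1 ↔ M e.unpair.2.unpair.1)) (s : ℤ) :
    ∀ᶠ l in atTop, 2 * levelWeight Q M l (s + 4 ^ l) = 0 := by
  by_cases hs : ∃ e : ℕ, s = 2 * 4 ^ e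
  · obtain ⟨e, rfl⟩ := hs
    by_cases he : ∀ l, Q e l
    · refine Eventually.of_forall fun l => ?_
      rw [add_comm, levelWeight_edge, if_neg fun h => h.2.2 (hM e he), mul_zero]
    · push Not at he
      obtain ⟨k, hk⟩ := he
      filter_upwards [eventually_ge_atTop k] with l hl
      rw [add_comm, levelWeight_edge, if_neg fun h => hk (hQ e k l hl h.2.1), mul_zero]
  · filter_upwards [eventually_gt_atTop |s|.toNat] with l hl
    rw [levelWeight]
    split_ifs with h₁ h₂ h₃
    · decide
    · obtain ⟨e, he, -⟩ := h₂
      exact absurd ⟨e, by omega⟩ hs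
    · obtain ⟨c, hc, -⟩ := h₃
      have h4 : (l : ℤ) < 4 ^ l := by exact_mod_cast Nat.lt_pow_self (by decide)
      have := neg_abs_le s
      omega
    · exact mul_zero _

theorem levelWeight_vanishes {m : ℕ} (hm : M m) {x : LaurentPolynomial (ZMod 4)}
    (hx : x ∈ stabilizerGroup Q m) : weight (levelWeight Q M l) x = 0 := by
  refine weight_eq_zero_of_mem (fun k => ?_) (fun k e he => ?_) hx
  · rw [levelWeight_pow, levelWeight_neg]
    by_cases hk : k = l
    · rw [if_pos hk, if_pos ⟨hk, hm⟩]; decide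
    · rw [if_neg hk, if_neg fun h => hk h.1]; decide
  · rw [levelWeight_edge, levelWeight_neg, levelWeight_neg]
    by_cases hk : k = l
    · subst hk
      by_cases h₁ : M e.unpair.1 <;> by_cases h₂ : M e.unpair.2.unpair.1 <;>
        simp only [h₁, h₂, he, true_and, not_true, not_false_iff, iff_true, iff_false, if_true,
          if_false] <;> decide
    · simp [hk]

end positions

section key
open LaurentPolynomial

theorem four_eq_zero : (4 : (ZMod 4)[T;T⁻¹]) = 0 := by
  rw [← map_ofNat (C (R := ZMod 4)) 4, show (OfNat.ofNat 4 : ZMod 4) = 0 by decide, map_zero]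

open Classical in
/-- The weight detecting a single position modulo two kills the stabilizer unless the position
is a power of four. -/
theorem exists_eq_pow_of_mem {Q : ℕ → ℕ → Prop} {m : ℕ} {q q' : ℤ} (hq : q ≠ q')
    {f : (ZMod 4)[T;T⁻¹]} (h : T q - T q' + 2 * f ∈ stabilizerGroup Q m) :
    ∃ k : ℕ, q = 4 ^ k := by
  by_contra! hk
  let wt : ℤ → ZMod 4 := fun i => if i = q then 2 else 0
  have h2 : ∀ i, 2 * wt i = 0 := fun i => by
    by_cases hi : i = q <;> simp only [wt, hi, if_true, if_false] <;> decide
  have h0 : weight wt (T q - T q' + 2 * f) = 0 :=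
    weight_eq_zero_of_mem (fun l => by rw [h2, add_zero]; exact if_neg (hk l).symm)
      (fun l e _ => by rw [mul_add, mul_add, h2, h2, h2]; rfl) h
  rw [map_add, weight_two_mul, two_mul_weight h2, map_sub, weight_T, weight_T] at h0
  simp only [wt, if_true, if_neg hq.symm] at h0
  exact absurd h0 (by decide)

theorem shift_eq_one_of_pow {ε c : ℤ} (hε : ε = 1 ∨ ε = -1) {S : Set ℕ} (hS : S.Infinite)
    (h : ∀ l ∈ S, ∃ k : ℕ, 4 ^ l * ε + c = (4 : ℤ) ^ k) : ε = 1 ∧ c = 0 := by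
  obtain ⟨l, hl, hlc⟩ := hS.exists_gt (4 * |c|).toNat
  obtain ⟨k, hk⟩ := h l hl
  have h4 : (l : ℤ) < 4 ^ l := by exact_mod_cast Nat.lt_pow_self (by decide)
  have hc := abs_nonneg c
  have hc' := le_abs_self c
  have hc'' := neg_abs_le c
  have hk0 : (0 : ℤ) < 4 ^ k := by positivity
  rcases hε with rfl | rfl
  · refine ⟨rfl, ?_⟩
    rcases lt_trichotomy k l with hkl | rfl | hkl
    · have : (4 : ℤ) ^ (k + 1) ≤ 4 ^ l := pow_le_pow_right₀ (by decide) hkl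
      rw [pow_succ] at this
      omega
    · omega
    · have : (4 : ℤ) ^ (l + 1) ≤ 4 ^ k := pow_le_pow_right₀ (by decide) hkl
      rw [pow_succ] at this
      omega
  · omega

/-- If infinitely many of the marks of the `n`-th presentation, expressed in terms of another
pair of generators of the lamplighter group, agree modulo the stabilizer of the `m`-th
presentation, then `n` belongs to the class of `m`. -/
theorem mem_class_of_marks {Q : ℕ → ℕ → Prop} {M : ℕ → Prop} {n m : ℕ}
    (hQ : ∀ e l k, l ≤ k → Q e k → Q e l)
    (hM : ∀ e, (∀ l, Q e l) → (M e.unpair.1 ↔ M e.unpair.2.unpair.1)) (hm : M m)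
    {ε d : ℤ} (hε : ε = 1 ∨ ε = -1) {p : (ZMod 4)[T;T⁻¹]} (hp : IsUnit p)
    {S : Set ℕ} (hS : S.Infinite)
    (h : ∀ l ∈ S, ∀ k ∈ S, T (-d) *
      ((T (4 ^ l * ε) + 2 * T (-(Nat.pair l n + 1) * ε)) * p -
        (T (4 ^ k * ε) + 2 * T (-(Nat.pair k n + 1) * ε)) * p) ∈ stabilizerGroup Q m) :
    M n := by
  obtain ⟨j, f, rfl⟩ := exists_eq_T_add_two_mul hp
  have hne : ∀ {l k : ℕ}, l ≠ k → 4 ^ l * ε + (j - d) ≠ 4 ^ k * ε + (j - d) := fun hlk heq => by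
    refine hlk (pow_four_injective ?_)
    rcases hε with rfl | rfl <;> omega
  obtain ⟨rfl, hj⟩ := shift_eq_one_of_pow (c := j - d) hε hS fun l hl => by
    obtain ⟨k, hk, hkl⟩ := hS.exists_gt l
    refine exists_eq_pow_of_mem (Q := Q) (m := m) (hne hkl.ne) (f := T (-d) * ((T (4 ^ l * ε) * f +
      T (-(Nat.pair l n + 1) * ε) * (T j + 2 * f)) - (T (4 ^ k * ε) * f +
      T (-(Nat.pair k n + 1) * ε) * (T j + 2 * f)))) ?_
    convert h l hl k hk using 1
    simp only [T_add, T_sub]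
    ring
  obtain rfl : j = d := by omega
  obtain ⟨k, hk⟩ := hS.nonempty
  obtain ⟨l, ⟨h₁, h₂⟩, hl⟩ := ((eventually_weight_eq_zero
    (eventually_levelWeight_eq_zero (Q := Q) (M := M))
    (T (-j) * ((T (4 ^ k * 1) + 2 * T (-(Nat.pair k n + 1) * 1)) * (T j + 2 * f)))).and
    (eventually_two_mul_weight_mul_T_eq_zero
      (eventually_two_mul_levelWeight_eq_zero hQ hM) (T (-j) * f))).and_frequently
    (Nat.frequently_atTop_iff_infinite.2 hS) |>.exists
  have h0 := levelWeight_vanishes l hm (h l hl k hk)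
  have hT : T (-j) * T j = (1 : (ZMod 4)[T;T⁻¹]) := by rw [← T_add, neg_add_cancel, T_zero]
  have hexp : T (-j) * ((T (4 ^ l * 1) + 2 * T (-(Nat.pair l n + 1) * 1)) * (T j + 2 * f)) =
      T (4 ^ l) + 2 * T (-(Nat.pair l n + 1)) + 2 * (T (-j) * f * T (4 ^ l)) := by
    rw [mul_one, mul_one]
    linear_combination (T (4 ^ l) + 2 * T (-(Nat.pair l n + 1))) * hT +
      (T (-j) * f * T (-(Nat.pair l n + 1))) * four_eq_zero
  rw [mul_sub, map_sub, h₁, hexp, map_add, map_add, weight_two_mul, weight_two_mul, h₂, weight_T,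
    weight_T, levelWeight_pow, levelWeight_neg, if_pos rfl] at h0
  by_contra hn
  rw [if_neg fun h => hn h.2] at h0
  exact absurd h0 (by decide)

end key

section backward
open LaurentPolynomial

attribute [local instance] Finsupp.comapSMul Finsupp.comapMulAction Finsupp.comapDistribMulAction

theorem Lamplighter.commute_of_shift {a b : Lamplighter} (ha : a.shift = 0) (hb : b.shift = 0) :
    Commute a b := by
  ext1
  · rw [base_mul, base_mul, ha, hb, add_comm, T_zero, one_mul, one_mul]
  · rw [shift_mul, shift_mul, add_comm]

/-- The base point of the set of cosets of the stabilizer group. -/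
noncomputable def basePoint (D : AddSubgroup (ZMod 4)[T;T⁻¹]) : Lamplighter.Cosets D := (0, 0)

theorem smul_basePoint {D : AddSubgroup (ZMod 4)[T;T⁻¹]} {g : Lamplighter} (hg : g.shift = 0)
    (h : g.base ∈ D) : g • basePoint D = basePoint D := by
  conv_rhs => rw [← one_smul Lamplighter (basePoint D)]
  rw [Lamplighter.smul_eq_smul_iff hg rfl]
  change T (-0) * (0 - g.base) ∈ D
  rw [neg_zero, T_zero, one_mul, zero_sub]
  exact neg_mem h

/-- The wreath product is a model of the `m`-th system of relations. -/
theorem satisfies_permWreath (Q : ℕ → ℕ → Prop) (m : ℕ) :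
    Satisfies Q m
      (PermWreath.inr ⟨0, 1⟩ : PermWreath Lamplighter (Lamplighter.Cosets (stabilizerGroup Q m)))
      (PermWreath.inr ⟨1, 0⟩) (PermWreath.light (basePoint _)) where
  base_pow := by
    rw [← map_pow, ← map_one PermWreath.inr]
    congr 1
    ext1
    · rw [Lamplighter.base_pow rfl]
      exact (congrArg (· * 1) four_eq_zero).trans (zero_mul _)
    · rw [Lamplighter.shift_pow]; rfl
  base_comm a := by
    rw [← map_conjPow]
    exact (Lamplighter.commute_of_shift rfl (Lamplighter.shift_conjPow _ rfl _)).map _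
  mark_pow := PermWreath.light_pow_three _
  mark_comm l := by
    rw [← map_markElt]
    refine PermWreath.commute_light_inr (smul_basePoint (Lamplighter.shift_markElt rfl _ _) ?_)
    rw [Lamplighter.base_markElt rfl]
    refine AddSubgroup.subset_closure (Or.inl ⟨l, ?_⟩)
    simp only [mul_one, markPoly]
  edge_comm l e he := by
    rw [← map_edgeElt, ← map_pow]
    refine PermWreath.commute_light_inr (smul_basePoint (Lamplighter.shift_edgeElt rfl _ _) ?_)
    rw [Lamplighter.base_edgeElt rfl]
    refine AddSubgroup.subset_closure (Or.inr ⟨l, e, he, ?_⟩)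
    simp only [mul_one, edgePoly]

theorem map_mem_closure_pair {G H : Type*} [Group G] [Group H] (f : G →* H) {t w u g : G}
    (hu : f u = 1) (hg : g ∈ Subgroup.closure {t, w, u}) :
    f g ∈ Subgroup.closure {f t, f w} := by
  suffices Subgroup.closure {t, w, u} ≤ (Subgroup.closure {f t, f w}).comap f from this hg
  rw [Subgroup.closure_le]
  rintro x (rfl | rfl | rfl)
  · exact Subgroup.subset_closure (Or.inl rfl)
  · exact Subgroup.subset_closure (Or.inr rfl)
  · exact (congrArg (· ∈ Subgroup.closure {f t, f w}) hu).mpr (one_mem _)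

theorem map_mem_closure_conjPow {G H : Type*} [Group G] [Group H] (f : G →* H) {t w b : G}
    (hb : b ∈ Subgroup.closure (Set.range (conjPow t w))) :
    f b ∈ Subgroup.closure (Set.range (conjPow (f t) (f w))) := by
  suffices Subgroup.closure (Set.range (conjPow t w)) ≤
    (Subgroup.closure (Set.range (conjPow (f t) (f w)))).comap f from this hb
  rw [Subgroup.closure_le]
  rintro _ ⟨q, rfl⟩
  exact Subgroup.subset_closure ⟨q, (map_conjPow f t w q).symm⟩

/-- A solution of the `n`-th system of relations in the wreath product model of the `m`-th
system can only generate the standard solution if `n` is in the class of `m`. -/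
theorem mem_class_of_satisfies {Q : ℕ → ℕ → Prop} {M : ℕ → Prop} {n m : ℕ}
    (hQ : ∀ e l k, l ≤ k → Q e k → Q e l)
    (hM : ∀ e, (∀ l, Q e l) → (M e.unpair.1 ↔ M e.unpair.2.unpair.1)) (hm : M m)
    {t w u : PermWreath Lamplighter (Lamplighter.Cosets (stabilizerGroup Q m))}
    (h : Satisfies Q n t w u)
    (h₁ : PermWreath.inr ⟨0, 1⟩ ∈ Subgroup.closure {t, w, u})
    (h₂ : PermWreath.inr ⟨1, 0⟩ ∈ Subgroup.closure {t, w, u})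
    (h₃ : PermWreath.light (basePoint _) ∈ Subgroup.closure {t, w, u}) : M n := by
  have hw : w.move.shift = 0 := Lamplighter.shift_eq_zero_of_pow four_ne_zero
    (congrArg PermWreath.moveHom h.base_pow)
  have hu : u.move = 1 := by
    have h3 : u.move ^ 3 = 1 := congrArg PermWreath.moveHom h.mark_pow
    have hs := Lamplighter.shift_eq_zero_of_pow three_ne_zero h3
    ext1
    · have := congrArg Lamplighter.base h3
      rw [Lamplighter.base_pow hs, Lamplighter.base_one] at this
      push_cast at this
      rw [Lamplighter.base_one]
      linear_combination u.move.base * four_eq_zero - this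
    · exact hs
  have hmove : ∀ {g}, g ∈ Subgroup.closure {t, w, u} →
      g.move ∈ Subgroup.closure {t.move, w.move} := fun hg =>
    map_mem_closure_pair PermWreath.moveHom hu hg
  obtain ⟨hε, hp⟩ := Lamplighter.shift_and_isUnit_of_mem_closure hw (hmove h₁) (hmove h₂)
  have hu1 : u.lamp ≠ 0 := fun hu0 => by
    obtain ⟨b, hb, k, hk⟩ := exists_mul_zpow_of_mem_closure_pair
      (map_mem_closure_pair (MonoidHom.id _) (PermWreath.ext hu0 hu) h₃)
    obtain ⟨hb0, -⟩ := Lamplighter.of_mem_closure_conjPow hw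
      (map_mem_closure_conjPow PermWreath.moveHom hb)
    have hk0 : k = 0 := by
      have := congrArg (fun g => (PermWreath.moveHom g).shift) hk
      simp only [map_mul, map_zpow, Lamplighter.shift_mul, Lamplighter.shift_zpow, hb0,
        zero_add] at this
      refine (mul_eq_zero.1 (this.symm.trans rfl)).resolve_right fun h0 => ?_
      rcases hε with hε | hε <;> exact absurd (hε.symm.trans h0) (by decide)
    rw [hk0, zpow_zero, mul_one] at hk
    have hb4 := h.pow_four_of_mem_closure hb
    rw [← hk, MonoidHom.id_apply, pow_succ, PermWreath.light_pow_three, one_mul] at hb4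
    exact PermWreath.light_ne_one _ hb4
  obtain ⟨c, hc⟩ := Finsupp.support_nonempty_iff.2 hu1
  obtain ⟨y, hy⟩ := Finite.exists_infinite_fiber fun l : ℕ => (⟨(markElt t w n l).move • c,
    PermWreath.smul_mem_support_of_commute hu (h.mark_comm l) hc⟩ : u.lamp.support)
  refine mem_class_of_marks (n := n) (d := c.2) hQ hM hm hε hp (Set.infinite_coe_iff.1 hy)
    fun l hl k hk => ?_
  have hmark : ∀ l, (markElt t w n l).move = markElt t.move w.move n l := fun l =>
    map_markElt PermWreath.moveHom t w n l
  have hlk : markElt t.move w.move n k • c = markElt t.move w.move n l • c := by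
    rw [← hmark, ← hmark]
    exact congrArg Subtype.val (hk.trans hl.symm)
  rw [Lamplighter.smul_eq_smul_iff (Lamplighter.shift_markElt hw _ _)
    (Lamplighter.shift_markElt hw _ _), Lamplighter.base_markElt hw,
    Lamplighter.base_markElt hw] at hlk
  exact hlk

end backward

section reduction

/-- An isomorphism between two of the presented groups forces their indices to share all
invariants `M` of the edge relation. -/
theorem mem_class_of_mulEquiv {good : ℕ → ℕ → ℕ → Bool} {M : ℕ → Prop} {n m : ℕ}
    (hgood : ∀ e l k, l ≤ k → (∃ s, good e k s = true) → ∃ s, good e l s = true)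
    (hM : ∀ e, (∀ l, ∃ s, good e l s = true) → (M e.unpair.1 ↔ M e.unpair.2.unpair.1))
    (hm : M m)
    (φ : PresentedGroup (Set.range fun k => FreeGroup.mk (stagedRelWord good n k)) ≃*
      PresentedGroup (Set.range fun k => FreeGroup.mk (stagedRelWord good m k))) : M n := by
  let Q : ℕ → ℕ → Prop := fun e l => ∃ s, good e l s = true
  let Γ : Type := PermWreath Lamplighter (Lamplighter.Cosets (stabilizerGroup Q m))
  let v : Fin 6 → Γ := ![PermWreath.inr ⟨0, 1⟩, PermWreath.inr ⟨1, 0⟩,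
    PermWreath.light (basePoint _), 1, 1, 1]
  have hv : ∀ r ∈ Set.range fun k => FreeGroup.mk (stagedRelWord good m k),
      FreeGroup.lift v r = 1 := by
    rintro _ ⟨k, rfl⟩
    refine (map_stagedRelWord_eq_one_iff good m (FreeGroup.lift v)).2 ⟨?_, ?_, ?_, ?_⟩ k
    · simp only [FreeGroup.lift_apply_of]
      exact satisfies_permWreath Q m
    all_goals simp [v]
  let g : FreeGroup (Fin 6) →* Γ :=
    ((PresentedGroup.toGroup hv).comp φ.toMonoidHom).comp (PresentedGroup.mk _)
  obtain ⟨hg, h3, h4, h5⟩ := (map_stagedRelWord_eq_one_iff good n g).1 fun k => by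
    have : PresentedGroup.mk (Set.range fun k => FreeGroup.mk (stagedRelWord good n k))
        (FreeGroup.mk (stagedRelWord good n k)) = 1 :=
      PresentedGroup.mk_eq_one_iff.2 (Subgroup.subset_normalClosure ⟨k, rfl⟩)
    rw [MonoidHom.comp_apply, this, map_one]
  have hmem : ∀ i, v i ∈
      Subgroup.closure {g (FreeGroup.of 0), g (FreeGroup.of 1), g (FreeGroup.of 2)} := fun i => by
    obtain ⟨x, hx⟩ := PresentedGroup.mk_surjective _ (φ.symm (PresentedGroup.of i))
    have hgx : g x = v i := by
      rw [MonoidHom.comp_apply, hx, MonoidHom.comp_apply]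
      exact (congrArg _ (φ.apply_symm_apply _)).trans (PresentedGroup.toGroup.of hv)
    suffices ∀ x, g x ∈
        Subgroup.closure {g (FreeGroup.of 0), g (FreeGroup.of 1), g (FreeGroup.of 2)} from
      hgx ▸ this x
    have hone : ∀ {y : Γ} {s : Set Γ}, y = 1 → y ∈ Subgroup.closure s := fun hy =>
      hy ▸ one_mem _
    intro x
    induction x using FreeGroup.induction_on with
    | C1 => exact hone (map_one g)
    | of i =>
      fin_cases i
      · exact Subgroup.subset_closure (Or.inl rfl)
      · exact Subgroup.subset_closure (Or.inr (Or.inl rfl))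
      · exact Subgroup.subset_closure (Or.inr (Or.inr rfl))
      · exact hone h3
      · exact hone h4
      · exact hone h5
    | inv_of i hi => rw [map_inv]; exact inv_mem hi
    | mul x y hx hy => rw [map_mul]; exact mul_mem hx hy
  exact mem_class_of_satisfies hgood hM hm hg (hmem 0) (hmem 1) (hmem 2)

/-- Whether `P` holds below `n`. -/
def allLt (P : ℕ → Bool) (n : ℕ) : Bool := Nat.rec true (fun y acc => acc && P y) n

theorem allLt_eq_true_iff (P : ℕ → Bool) (n : ℕ) : allLt P n = true ↔ ∀ y < n, P y = true := by
  induction n with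
  | zero => simp [allLt]
  | succ k ih =>
    rw [show allLt P (k + 1) = (allLt P k && P k) from rfl, Bool.and_eq_true, ih]
    exact Nat.forall_lt_succ_right.symm

theorem computable_allLt {α : Type*} [Primcodable α] {P : α → ℕ → Bool} (hP : Computable₂ P)
    {n : α → ℕ} (hn : Computable n) : Computable fun a => allLt (P a) (n a) :=
  Computable.nat_rec hn (Computable.const true)
    (Primrec.and.to_comp.comp (Computable.snd.comp Computable.snd)
      (hP.comp Computable.fst (Computable.fst.comp Computable.snd))).to₂

theorem computable_comp₄ {α : Type*} [Primcodable α] {f : ℕ → ℕ → ℕ → ℕ → Bool}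
    (hf : Computable fun p : ℕ × ℕ × ℕ × ℕ => f p.1 p.2.1 p.2.2.1 p.2.2.2) {a b c d : α → ℕ}
    (ha : Computable a) (hb : Computable b) (hc : Computable c) (hd : Computable d) :
    Computable fun p => f (a p) (b p) (c p) (d p) :=
  hf.comp (ha.pair (hb.pair (hc.pair hd)))

/-- The edge relation attached to a Σ⁰₃ relation: the edge `e = (a, (b, x))` is present at level
`l` if the Π⁰₂ condition with first witness `x` for the pair `(a, b)` has been verified up to
`l`. -/
theorem exists_good {R : ℕ → ℕ → ℕ → ℕ → Bool}
    (hR : Computable fun p : ℕ × ℕ × ℕ × ℕ => R p.1 p.2.1 p.2.2.1 p.2.2.2) :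
    ∃ good : ℕ → ℕ → ℕ → Bool, (Computable fun p : ℕ × ℕ × ℕ => good p.1 p.2.1 p.2.2) ∧
      ∀ e l, (∃ s, good e l s = true) ↔
        ∀ y ≤ l, ∃ z, R (Nat.pair e.unpair.1 e.unpair.2.unpair.1) e.unpair.2.unpair.2 y z = true := by
  let P : ℕ × ℕ × ℕ → ℕ → Bool := fun p y =>
    R (Nat.pair p.1.unpair.1 p.1.unpair.2.unpair.1) p.1.unpair.2.unpair.2 y
      ((Denumerable.ofNat (List ℕ) p.2.2).getD y 0)
  have hP : Computable₂ P := by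
    have he : Primrec fun p : (ℕ × ℕ × ℕ) × ℕ => p.1.1 := Primrec.fst.comp Primrec.fst
    have ha : Primrec fun p : (ℕ × ℕ × ℕ) × ℕ => p.1.1.unpair.1 :=
      Primrec.fst.comp (Primrec.unpair.comp he)
    have he' : Primrec fun p : (ℕ × ℕ × ℕ) × ℕ => p.1.1.unpair.2 :=
      Primrec.snd.comp (Primrec.unpair.comp he)
    have hb : Primrec fun p : (ℕ × ℕ × ℕ) × ℕ => p.1.1.unpair.2.unpair.1 :=
      Primrec.fst.comp (Primrec.unpair.comp he')
    have hx : Primrec fun p : (ℕ × ℕ × ℕ) × ℕ => p.1.1.unpair.2.unpair.2 :=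
      Primrec.snd.comp (Primrec.unpair.comp he')
    have hs : Primrec fun p : (ℕ × ℕ × ℕ) × ℕ => p.1.2.2 :=
      Primrec.snd.comp (Primrec.snd.comp Primrec.fst)
    have hz : Primrec fun p : (ℕ × ℕ × ℕ) × ℕ =>
        (Denumerable.ofNat (List ℕ) p.1.2.2).getD p.2 0 :=
      (Primrec.list_getD 0).comp ((Primrec.ofNat _).comp hs) Primrec.snd
    exact computable_comp₄ hR (Primrec₂.natPair.comp ha hb).to_comp hx.to_comp
      Computable.snd hz.to_comp
  refine ⟨fun e l s => allLt (P (e, l, s)) (l + 1),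
    computable_allLt hP (Computable.succ.comp (Computable.fst.comp Computable.snd)),
    fun e l => ⟨fun ⟨s, hs⟩ y hy =>
      ⟨_, (allLt_eq_true_iff _ _).1 hs y (Nat.lt_succ_of_le hy)⟩, fun h => ?_⟩⟩
  choose! z hz using h
  refine ⟨Encodable.encode ((List.range (l + 1)).map z),
    (allLt_eq_true_iff _ _).2 fun y hy => ?_⟩
  have : ((List.range (l + 1)).map z).getD y 0 = z y := by
    rw [List.getD_eq_getElem _ _ (by simpa using hy)]
    simp
  simp only [P]
  rw [Denumerable.ofNat_encode, this]
  exact hz y (Nat.le_of_lt_succ hy)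

theorem computableReduction_groupIso6 {E : ℕ → ℕ → Prop} (hE : Equivalence E)
    (hS : Sigma03Rel E) : ComputableReduction E GroupIso6 := by
  obtain ⟨R, hR, hER⟩ := hS
  obtain ⟨good, hgood, hgR⟩ := exists_good hR
  obtain ⟨Φ, hΦ, hrel⟩ := exists_computable_relSet (computable_stagedRelWord hgood)
  have hER' : ∀ a b, E a b ↔ ∃ x, ∀ y, ∃ z, R (Nat.pair a b) x y z = true := fun a b => by
    rw [← hER]
    simp
  have hedge : ∀ e, (∀ l, ∃ s, good e l s = true) → E e.unpair.1 e.unpair.2.unpair.1 :=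
    fun e he => (hER' _ _).2 ⟨_, fun y => (hgR e y).1 (he y) y le_rfl⟩
  refine ⟨Φ, hΦ, fun m n => ?_⟩
  rw [GroupIso6, hrel, hrel]
  constructor
  · intro h
    obtain ⟨x, hx⟩ := (hER' m n).1 h
    refine nonempty_mulEquiv_of_edge (e := Nat.pair m (Nat.pair n x)) (fun l => ?_)
      (by simp) (by simp)
    rw [hgR]
    simpa using fun y _ => hx y
  · rintro ⟨φ⟩
    refine mem_class_of_mulEquiv (M := fun c => E c n) (fun e l k hlk hk => ?_)
      (fun e he => ?_) (hE.refl n) φ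
    · rw [hgR] at hk ⊢
      exact fun y hy => hk y (hy.trans hlk)
    · have := hedge e he
      exact ⟨hE.trans (hE.symm this), hE.trans this⟩

end reduction

/-- The isomorphism problem for `6`-generated recursively presented groups is a
Σ⁰₃-complete equivalence relation. -/
theorem isomorphismProblem_sixGenerated_Sigma03Complete :
    Equivalence GroupIso6 ∧ Sigma03Rel GroupIso6 ∧
      ∀ E : ℕ → ℕ → Prop, Equivalence E → Sigma03Rel E → ComputableReduction E GroupIso6 :=
  ⟨equivalence_groupIso6, sigma03Rel_groupIso6, fun _ => computableReduction_groupIso6⟩
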